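/- arXiv:1203.6303 — 2 statements merged into one kernel-verified Lean document; each statement's English description precedes it below -/
import Mathlib

section
/- There exist a continuous, coercive, level-set convex function H̄ : ℝ^d → ℝ and an event Ω₀ ⊆ Ω of full probability such that for every ω ∈ Ω₀ the following holds: if for each ε > 0, u^ε(·,ω) is a bounded Lipschitz viscosity solution of u^ε + H(Du^ε, x/ε, ω) = 0 in ℝ^d, then u^ε(·,ω) converges locally uniformly on ℝ^d, as ε → 0, to the constant −H̄(0), the unique constant u solving u + H̄(Du) = 0. -/
open MeasureTheory Filter Topology Bornology
open scoped RealInnerProductSpace NNReal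

noncomputable section

/-- Euclidean space ℝ^d. -/
abbrev Ed (d : ℕ) := EuclideanSpace ℝ (Fin d)

/-- The set 𝓛 of globally Lipschitz real-valued functions on ℝ^d. -/
def LipFuns (d : ℕ) : Set (Ed d → ℝ) := {w | ∃ C : ℝ≥0, LipschitzWith C w}

/-- SL⁺ : Lipschitz functions sublinear from below, i.e. liminf_{|y|→∞} w(y)/|y| ≥ 0. -/
def SLplus (d : ℕ) : Set (Ed d → ℝ) :=
  {w | w ∈ LipFuns d ∧ ∀ ε : ℝ, 0 < ε → ∃ R : ℝ, ∀ y : Ed d, R ≤ ‖y‖ → -ε ≤ w y / ‖y‖}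

/-- SL⁻ : Lipschitz functions sublinear from above, i.e. limsup_{|y|→∞} w(y)/|y| ≤ 0. -/
def SLminus (d : ℕ) : Set (Ed d → ℝ) :=
  {w | w ∈ LipFuns d ∧ ∀ ε : ℝ, 0 < ε → ∃ R : ℝ, ∀ y : Ed d, R ≤ ‖y‖ → w y / ‖y‖ ≤ ε}

/-- 𝓢 : Lipschitz functions strictly sublinear at infinity. -/
def Scal (d : ℕ) : Set (Ed d → ℝ) := SLplus d ∩ SLminus d

/-- H̄₊(p) = inf_{w ∈ SL⁺} esssup_y H(p + Dw(y), y). -/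
def HbarPlus (d : ℕ) (H : Ed d → Ed d → ℝ) (p : Ed d) : ℝ :=
  sInf {t | ∃ w ∈ SLplus d, t = essSup (fun y => H (p + gradient w y) y) volume}

/-- H̄₋(p) = inf_{w ∈ SL⁻} esssup_y H(p + Dw(y), y). -/
def HbarMinus (d : ℕ) (H : Ed d → Ed d → ℝ) (p : Ed d) : ℝ :=
  sInf {t | ∃ w ∈ SLminus d, t = essSup (fun y => H (p + gradient w y) y) volume}

/-- Ĥ(p) = inf_{w ∈ 𝓢} esssup_y H(p + Dw(y), y). -/
def Hhat (d : ℕ) (H : Ed d → Ed d → ℝ) (p : Ed d) : ℝ :=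
  sInf {t | ∃ w ∈ Scal d, t = essSup (fun y => H (p + gradient w y) y) volume}

/-- H̄* = inf_{w ∈ 𝓛} esssup_y H(Dw(y), y). -/
def Hstar (d : ℕ) (H : Ed d → Ed d → ℝ) : ℝ :=
  sInf {t | ∃ w ∈ LipFuns d, t = essSup (fun y => H (gradient w y) y) volume}

/-- m_μ(y,x) = sup { w(y) − w(x) : w ∈ 𝓛, H(Dw,z) ≤ μ a.e. }. -/
def mMu (d : ℕ) (H : Ed d → Ed d → ℝ) (μ : ℝ) (y x : Ed d) : ℝ :=
  sSup {t | ∃ w ∈ LipFuns d, (∀ᵐ z ∂volume, H (gradient w z) z ≤ μ) ∧ t = w y - w x}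

/-- Viscosity subsolution of F(Du, y) ≤ μ in U. -/
def ViscSub (d : ℕ) (F : Ed d → Ed d → ℝ) (μ : ℝ) (U : Set (Ed d)) (u : Ed d → ℝ) : Prop :=
  ∀ (φ : Ed d → ℝ) (x₀ : Ed d), x₀ ∈ U → ContDiffAt ℝ 1 φ x₀ →
    IsLocalMaxOn (fun y => u y - φ y) U x₀ → F (gradient φ x₀) x₀ ≤ μ

/-- Viscosity supersolution of F(Dv, y) ≥ μ in U. -/
def ViscSuper (d : ℕ) (F : Ed d → Ed d → ℝ) (μ : ℝ) (U : Set (Ed d)) (v : Ed d → ℝ) : Prop :=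
  ∀ (φ : Ed d → ℝ) (x₀ : Ed d), x₀ ∈ U → ContDiffAt ℝ 1 φ x₀ →
    IsLocalMinOn (fun y => v y - φ y) U x₀ → μ ≤ F (gradient φ x₀) x₀ 

/-- ω-dependent H̄₊. -/
def HbarPlusOm (d : ℕ) {Ω : Type*} (H : Ed d → Ed d → Ω → ℝ) (p : Ed d) (ω : Ω) : ℝ :=
  sInf {t | ∃ w ∈ SLplus d, t = essSup (fun y => H (p + gradient w y) y ω) volume}

/-- ω-dependent H̄₋. -/
def HbarMinusOm (d : ℕ) {Ω : Type*} (H : Ed d → Ed d → Ω → ℝ) (p : Ed d) (ω : Ω) : ℝ :=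
  sInf {t | ∃ w ∈ SLminus d, t = essSup (fun y => H (p + gradient w y) y ω) volume}

/-- ω-dependent Ĥ. -/
def HhatOm (d : ℕ) {Ω : Type*} (H : Ed d → Ed d → Ω → ℝ) (p : Ed d) (ω : Ω) : ℝ :=
  sInf {t | ∃ w ∈ Scal d, t = essSup (fun y => H (p + gradient w y) y ω) volume}

/-- ω-dependent H̄*. -/
def HstarOm (d : ℕ) {Ω : Type*} (H : Ed d → Ed d → Ω → ℝ) (ω : Ω) : ℝ :=
  sInf {t | ∃ w ∈ LipFuns d, t = essSup (fun y => H (gradient w y) y ω) volume}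

/-- ω-dependent metric problem solution m_μ(y,x,ω). -/
def mMuOm (d : ℕ) {Ω : Type*} (H : Ed d → Ed d → Ω → ℝ) (μ : ℝ) (y x : Ed d) (ω : Ω) : ℝ :=
  sSup {t | ∃ w ∈ LipFuns d, (∀ᵐ z ∂volume, H (gradient w z) z ω ≤ μ) ∧ t = w y - w x}

/-- Viscosity subsolution property for u + G(Du,y) ≤ 0 in all of ℝ^d. -/
def ViscSubZero (d : ℕ) (G : Ed d → Ed d → ℝ) (u : Ed d → ℝ) : Prop :=
  ∀ (φ : Ed d → ℝ) (x₀ : Ed d), ContDiffAt ℝ 1 φ x₀ →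
    IsLocalMax (fun y => u y - φ y) x₀ → u x₀ + G (gradient φ x₀) x₀ ≤ 0

/-- Viscosity supersolution property for u + G(Du,y) ≥ 0 in all of ℝ^d. -/
def ViscSuperZero (d : ℕ) (G : Ed d → Ed d → ℝ) (u : Ed d → ℝ) : Prop :=
  ∀ (φ : Ed d → ℝ) (x₀ : Ed d), ContDiffAt ℝ 1 φ x₀ →
    IsLocalMin (fun y => u y - φ y) x₀ → 0 ≤ u x₀ + G (gradient φ x₀) x₀


/-! ### Quadratic test functions -/

/-- Subsolution property of `ε v + F(Dv,y) ≤ 0` tested with quadratic functions. -/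
def QSub (d : ℕ) (F : Ed d → Ed d → ℝ) (ε : ℝ) (v : Ed d → ℝ) : Prop :=
  ∀ (α : ℝ) (a x : Ed d), IsLocalMax (fun y => v y - α * ‖y - a‖ ^ 2) x →
    ε * v x + F ((2 * α) • (x - a)) x ≤ 0

/-- Supersolution property of `ε v + F(Dv,y) ≥ 0` tested with quadratic functions. -/
def QSuper (d : ℕ) (F : Ed d → Ed d → ℝ) (ε : ℝ) (v : Ed d → ℝ) : Prop :=
  ∀ (α : ℝ) (a x : Ed d), IsLocalMin (fun y => v y - α * ‖y - a‖ ^ 2) x →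
    0 ≤ ε * v x + F ((2 * α) • (x - a)) x

lemma gradient_quad {d : ℕ} (β : ℝ) (a x : Ed d) :
    gradient (fun y : Ed d => β * ‖y - a‖ ^ 2) x = (2 * β) • (x - a) := by
  apply HasGradientAt.gradient
  rw [hasGradientAt_iff_hasFDerivAt]
  have h1 : HasFDerivAt (fun y : Ed d => y - a) (ContinuousLinearMap.id ℝ (Ed d)) x :=
    (hasFDerivAt_id x).sub_const a
  have h2 := (h1.norm_sq).const_mul β
  refine h2.congr_fderiv ?_
  ext y
  simp
  ring

lemma contDiffAt_quad {d : ℕ} (β : ℝ) (a x : Ed d) :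
    ContDiffAt ℝ 1 (fun y : Ed d => β * ‖y - a‖ ^ 2) x := by
  have : ContDiff ℝ 1 (fun y : Ed d => β * ‖y - a‖ ^ 2) :=
    contDiff_const.mul ((contDiff_id.sub contDiff_const).norm_sq ℝ)
  exact this.contDiffAt

lemma quad_rescale {d : ℕ} {ε : ℝ} (hε : 0 < ε) (α : ℝ) (a y : Ed d) :
    (α / ε) * ‖y - ε • a‖ ^ 2 = ε * (α * ‖ε⁻¹ • y - a‖ ^ 2) := by
  have : y - ε • a = ε • (ε⁻¹ • y - a) := by
    rw [smul_sub, smul_smul, mul_inv_cancel₀ hε.ne', one_smul]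
  rw [this, norm_smul, Real.norm_of_nonneg hε.le]
  field_simp

lemma tendsto_inv_smul {d : ℕ} {ε : ℝ} (hε : 0 < ε) (x : Ed d) :
    Tendsto (fun y : Ed d => ε⁻¹ • y) (𝓝 (ε • x)) (𝓝 x) := by
  have : Continuous (fun y : Ed d => ε⁻¹ • y) := by fun_prop
  have h := this.tendsto (ε • x)
  rwa [smul_smul, inv_mul_cancel₀ hε.ne', one_smul] at h

lemma qsub_of_visc {d : ℕ} {F : Ed d → Ed d → ℝ} {ε : ℝ} (hε : 0 < ε) {u : Ed d → ℝ}
    (h : ViscSubZero d (fun q x => F q (ε⁻¹ • x)) u) :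
    QSub d F ε (fun y => ε⁻¹ * u (ε • y)) := by
  intro α a x hx
  have h1 := h (fun y => (α / ε) * ‖y - ε • a‖ ^ 2) (ε • x) (contDiffAt_quad _ _ _) ?_
  · rw [gradient_quad] at h1
    have e1 : (2 * (α / ε)) • (ε • x - ε • a) = (2 * α) • (x - a) := by
      rw [← smul_sub, smul_smul]; congr 1; field_simp
    have e3 : ε⁻¹ • ε • x = x := by rw [smul_smul, inv_mul_cancel₀ hε.ne', one_smul]
    have e4 : ε * (ε⁻¹ * u (ε • x)) = u (ε • x) := mul_inv_cancel_left₀ hε.ne' _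
    simp only [e1, e3] at h1
    simp only [e4]
    exact h1
  · have h2 := (tendsto_inv_smul hε x).eventually hx
    filter_upwards [h2] with y hy
    have e2 : ∀ z : Ed d, u z - (α / ε) * ‖z - ε • a‖ ^ 2
        = ε * (ε⁻¹ * u (ε • (ε⁻¹ • z)) - α * ‖ε⁻¹ • z - a‖ ^ 2) := by
      intro z
      rw [quad_rescale hε, smul_smul, mul_inv_cancel₀ hε.ne', one_smul, mul_sub,
        mul_inv_cancel_left₀ hε.ne']
    rw [e2 y, e2 (ε • x)]
    apply mul_le_mul_of_nonneg_left _ hε.le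
    have e3 : ε⁻¹ • ε • x = x := by rw [smul_smul, inv_mul_cancel₀ hε.ne', one_smul]
    rw [e3]
    exact hy

lemma qsuper_of_visc {d : ℕ} {F : Ed d → Ed d → ℝ} {ε : ℝ} (hε : 0 < ε) {u : Ed d → ℝ}
    (h : ViscSuperZero d (fun q x => F q (ε⁻¹ • x)) u) :
    QSuper d F ε (fun y => ε⁻¹ * u (ε • y)) := by
  intro α a x hx
  have h1 := h (fun y => (α / ε) * ‖y - ε • a‖ ^ 2) (ε • x) (contDiffAt_quad _ _ _) ?_
  · rw [gradient_quad] at h1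
    have e1 : (2 * (α / ε)) • (ε • x - ε • a) = (2 * α) • (x - a) := by
      rw [← smul_sub, smul_smul]; congr 1; field_simp
    have e3 : ε⁻¹ • ε • x = x := by rw [smul_smul, inv_mul_cancel₀ hε.ne', one_smul]
    have e4 : ε * (ε⁻¹ * u (ε • x)) = u (ε • x) := mul_inv_cancel_left₀ hε.ne' _
    simp only [e1, e3] at h1
    simp only [e4]
    exact h1
  · have h2 := (tendsto_inv_smul hε x).eventually hx
    filter_upwards [h2] with y hy
    have e2 : ∀ z : Ed d, u z - (α / ε) * ‖z - ε • a‖ ^ 2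
        = ε * (ε⁻¹ * u (ε • (ε⁻¹ • z)) - α * ‖ε⁻¹ • z - a‖ ^ 2) := by
      intro z
      rw [quad_rescale hε, smul_smul, mul_inv_cancel₀ hε.ne', one_smul, mul_sub,
        mul_inv_cancel_left₀ hε.ne']
    rw [e2 y, e2 (ε • x)]
    apply mul_le_mul_of_nonneg_left _ hε.le
    have e3 : ε⁻¹ • ε • x = x := by rw [smul_smul, inv_mul_cancel₀ hε.ne', one_smul]
    rw [e3]
    exact hy

lemma qsub_neg {d : ℕ} {F : Ed d → Ed d → ℝ} {ε : ℝ} {v : Ed d → ℝ} (h : QSuper d F ε v) :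
    QSub d (fun p y => - F (-p) y) ε (fun y => - v y) := by
  intro α a x hx
  have h1 := h (-α) a x ?_
  · have e1 : (2 * -α) • (x - a) = -((2 * α) • (x - a)) := by
      rw [← neg_smul]; congr 1; ring
    rw [e1] at h1
    linarith
  · filter_upwards [hx] with y hy
    linarith

/-- A priori upper bound. -/
lemma qsub_bound {d : ℕ} {F : Ed d → Ed d → ℝ} {ε : ℝ} (hε : 0 < ε) {v : Ed d → ℝ}
    (h : QSub d F ε v) (hv : Continuous v) {M : ℝ} (hM : ∀ x, |v x| ≤ M) {M0 : ℝ}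
    (hM0 : ∀ p y, ‖p‖ ≤ 1 → |F p y| ≤ M0) (x : Ed d) : ε * v x ≤ M0 := by
  have hMpos : 0 ≤ M := (abs_nonneg _).trans (hM 0)
  set α : ℝ := 1 / (8 * (M + 1)) with hα
  have hαpos : 0 < α := by positivity
  obtain ⟨y, hy⟩ : ∃ y, ∀ z, v z - α * ‖z - x‖ ^ 2 ≤ v y - α * ‖y - x‖ ^ 2 := by
    apply Continuous.exists_forall_ge' (by fun_prop) x
    have h1 : Tendsto (fun z : Ed d => ‖z - x‖) (cocompact (Ed d)) atTop := by
      have := tendsto_dist_left_cocompact_atTop x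
      refine this.congr (fun z => ?_)
      rw [dist_comm, dist_eq_norm]
    filter_upwards [h1.eventually_ge_atTop (4 * (M + 1))] with z hz
    have a1 := abs_le.1 (hM z)
    have a2 := abs_le.1 (hM x)
    have : 2 * (M + 1) ≤ α * ‖z - x‖ ^ 2 := by
      rw [hα, div_mul_eq_mul_div, le_div_iff₀ (by positivity)]
      nlinarith
    simp
    linarith
  have h1 := h α x y (Eventually.of_forall hy)
  have h2 := hy x
  simp at h2
  have a1 := abs_le.1 (hM y)
  have a2 := abs_le.1 (hM x)
  have h3 : ‖(2 * α) • (y - x)‖ ≤ 1 := by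
    rw [norm_smul, Real.norm_of_nonneg (by positivity)]
    have h4 : α * ‖y - x‖ ^ 2 ≤ 2 * M := by linarith
    have h5 : (2 * α * ‖y - x‖) ^ 2 ≤ 1 := by
      have : (2 * α * ‖y - x‖) ^ 2 = 4 * α * (α * ‖y - x‖ ^ 2) := by ring
      rw [this]
      calc 4 * α * (α * ‖y - x‖ ^ 2) ≤ 4 * α * (2 * M) := by gcongr
        _ = M / (M + 1) := by rw [hα]; field_simp; ring
        _ ≤ 1 := by rw [div_le_one (by positivity)]; linarith
    have h6 : 0 ≤ 2 * α * ‖y - x‖ := by positivity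
    nlinarith
  have h7 := abs_le.1 (hM0 _ y h3)
  have h8 : v x ≤ v y := by nlinarith [sq_nonneg ‖y - x‖]
  have := mul_le_mul_of_nonneg_left h8 hε.le
  linarith

lemma qsuper_bound {d : ℕ} {F : Ed d → Ed d → ℝ} {ε : ℝ} (hε : 0 < ε) {v : Ed d → ℝ}
    (h : QSuper d F ε v) (hv : Continuous v) {M : ℝ} (hM : ∀ x, |v x| ≤ M) {M0 : ℝ}
    (hM0 : ∀ p y, ‖p‖ ≤ 1 → |F p y| ≤ M0) (x : Ed d) : -M0 ≤ ε * v x := by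
  have := qsub_bound hε (qsub_neg h) hv.neg (M := M) (by simpa using hM) (M0 := M0)
    (by intro p y hp; simpa using hM0 (-p) y (by simpa using hp)) x
  simp at this
  linarith

/-! ### Increments of subsolutions along segments -/

lemma qsub_segment {d : ℕ} {F : Ed d → Ed d → ℝ} {ε : ℝ} {v : Ed d → ℝ}
    (h : QSub d F ε v) (hv : Continuous v) {y q : Ed d} {r a : ℝ} (hq : ‖q‖ < r)
    (hH : ∀ z p : Ed d, ‖z - y‖ ≤ r → ε * v z + F p z ≤ 0 → ⟪p, q⟫ ≤ a) :
    v (y + q) ≤ v y + a := by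
  apply le_of_forall_pos_le_add
  intro η hη
  have hr : 0 < r := (norm_nonneg q).trans_lt hq
  obtain ⟨B, hB⟩ := (isCompact_closedBall y r).exists_bound_of_continuousOn hv.continuousOn
  have hB' : ∀ z : Ed d, ‖z - y‖ ≤ r → |v z| ≤ B := by
    intro z hz
    exact hB z (by rwa [Metric.mem_closedBall, dist_eq_norm])
  have hB0 : 0 ≤ B := (abs_nonneg _).trans (hB' y (by simpa using hr.le))
  obtain ⟨δ, hδ, hδv⟩ := Metric.continuous_iff.1 hv y (η / 2) (by positivity)
  set s : ℝ := min (r - ‖q‖) δ with hs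
  have hspos : 0 < s := lt_min (by linarith) hδ
  set α : ℝ := (2 * B + 1) / s ^ 2 with hα
  have hαpos : 0 < α := by positivity
  set Φ : Ed d × ℝ → ℝ := fun x => v x.1 - x.2 * (a + η / 2) - α * ‖x.1 - (y + x.2 • q)‖ ^ 2
    with hΦ
  obtain ⟨⟨z, t⟩, hzt, hmax⟩ := ((isCompact_closedBall y r).prod
    (isCompact_Icc (a := (0:ℝ)) (b := 1))).exists_isMaxOn
      ⟨(y, 0), by simp [hr.le]⟩ (f := Φ) (by apply Continuous.continuousOn; fun_prop)
  have hmax' : ∀ z' t', ‖z' - y‖ ≤ r → 0 ≤ t' → t' ≤ 1 → Φ (z', t') ≤ Φ (z, t) := by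
    intro z' t' h1 h2 h3
    exact hmax ⟨by rwa [Metric.mem_closedBall, dist_eq_norm], h2, h3⟩
  obtain ⟨hz, ht0, ht1⟩ := hzt
  simp only at hz ht0 ht1
  rw [Metric.mem_closedBall, dist_eq_norm] at hz
  have htq : ‖t • q‖ ≤ ‖q‖ := by
    rw [norm_smul, Real.norm_of_nonneg ht0]
    nlinarith [norm_nonneg q]
  have h1 := hmax' (y + t • q) t (by simpa using htq.trans hq.le) ht0 ht1
  have hw : ‖z - (y + t • q)‖ < s := by
    simp only [hΦ, sub_self, norm_zero] at h1
    have b1 := abs_le.1 (hB' z hz)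
    have b2 := abs_le.1 (hB' (y + t • q) (by simpa using htq.trans hq.le))
    have h2 : α * ‖z - (y + t • q)‖ ^ 2 ≤ 2 * B := by
      norm_num at h1
      linarith
    by_contra hcon
    push Not at hcon
    have h3 : s ^ 2 ≤ ‖z - (y + t • q)‖ ^ 2 := by gcongr
    have h4 : 2 * B + 1 ≤ α * ‖z - (y + t • q)‖ ^ 2 := by
      calc 2 * B + 1 = α * s ^ 2 := by rw [hα]; field_simp
        _ ≤ _ := by gcongr
    linarith
  have hzint : ‖z - y‖ < r := by
    have : z - y = (z - (y + t • q)) + t • q := by abel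
    rw [this]
    calc _ ≤ ‖z - (y + t • q)‖ + ‖t • q‖ := norm_add_le _ _
      _ < r := by
        have := hw.trans_le (min_le_left _ _)
        linarith
  have hloc : IsLocalMax (fun x => v x - α * ‖x - (y + t • q)‖ ^ 2) z := by
    have : Metric.ball y r ∈ 𝓝 z := Metric.isOpen_ball.mem_nhds (by
      rwa [Metric.mem_ball, dist_eq_norm])
    filter_upwards [this] with x hx
    rw [Metric.mem_ball, dist_eq_norm] at hx
    have := hmax' x t hx.le ht0 ht1
    simp only [hΦ] at this
    linarith
  have hp := hH z _ hz (h α _ z hloc)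
  rw [inner_smul_left] at hp
  simp only [conj_trivial] at hp
  -- the maximum is attained at t = 0
  have ht : t = 0 := by
    by_contra hne
    have htpos : 0 < t := lt_of_le_of_ne ht0 (Ne.symm hne)
    have key : ∀ τ : ℝ, 0 < τ → τ ≤ t →
        a + η / 2 ≤ 2 * α * ⟪z - (y + t • q), q⟫ + τ * (α * ‖q‖ ^ 2) := by
      intro τ hτ hτt
      have h2 := hmax' z (t - τ) hz (by linarith) (by linarith)
      simp only [hΦ] at h2
      have e : z - (y + (t - τ) • q) = (z - (y + t • q)) + τ • q := by
        rw [sub_smul]; abel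
      rw [e, norm_add_sq_real, inner_smul_right, norm_smul, Real.norm_of_nonneg hτ.le] at h2
      have h3 : τ * (a + η / 2) ≤ τ * (2 * α * ⟪z - (y + t • q), q⟫ + τ * (α * ‖q‖ ^ 2)) := by
        nlinarith
      exact le_of_mul_le_mul_left h3 hτ
    have hK : 0 < α * ‖q‖ ^ 2 + 1 := by positivity
    set τ := min t (η / 4 / (α * ‖q‖ ^ 2 + 1)) with hτ
    have hτpos : 0 < τ := lt_min htpos (by positivity)
    have h2 := key τ hτpos (min_le_left _ _)
    have h3 : τ * (α * ‖q‖ ^ 2 + 1) ≤ η / 4 := by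
      have : τ ≤ η / 4 / (α * ‖q‖ ^ 2 + 1) := min_le_right _ _
      rwa [le_div_iff₀ hK] at this
    nlinarith
  subst ht
  have h5 := hmax' (y + q) 1 (by simpa using hq.le) zero_le_one le_rfl
  simp only [hΦ, one_smul, sub_self, norm_zero, zero_smul, add_zero] at h5
  simp only [zero_smul, add_zero] at hw
  have h6 := hδv z (by rw [dist_eq_norm]; exact hw.trans_le (min_le_right _ _))
  rw [Real.dist_eq] at h6
  have h7 := (abs_lt.1 h6).2
  have h8 : 0 ≤ α * ‖z - y‖ ^ 2 := by positivity
  norm_num at h5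
  linarith

/-! ### The regularised support function -/

/-- Penalised support function of the sublevel set `{F(·,z) ≤ μ}`. -/
def ell {d : ℕ} (pk : ℕ → Ed d) (N μ : ℝ) (F : Ed d → Ed d → ℝ) (q z : Ed d) : ℝ :=
  ⨆ k, (⟪pk k, q⟫ - N * ‖q‖ * max (F (pk k) z - μ) 0)

/-- `pk` is a dense sequence of the closed ball of radius `R`. -/
def DenseBall {d : ℕ} (pk : ℕ → Ed d) (R : ℝ) : Prop :=
  (∀ k, ‖pk k‖ ≤ R) ∧ ∀ p : Ed d, ‖p‖ ≤ R → ∀ δ : ℝ, 0 < δ → ∃ k, ‖pk k - p‖ < δ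

lemma exists_denseBall (d : ℕ) {R : ℝ} (hR : 0 ≤ R) : ∃ pk : ℕ → Ed d, DenseBall pk R := by
  have : Nonempty (Metric.closedBall (0 : Ed d) R) := ⟨⟨0, by simpa using hR⟩⟩
  refine ⟨fun k => (TopologicalSpace.denseSeq (Metric.closedBall (0 : Ed d) R) k : Ed d), ?_, ?_⟩
  · intro k
    exact mem_closedBall_zero_iff.1 (TopologicalSpace.denseSeq (Metric.closedBall (0 : Ed d) R) k).2
  · intro p hp δ hδ
    obtain ⟨k, hk⟩ := (TopologicalSpace.denseRange_denseSeq
      (Metric.closedBall (0 : Ed d) R)).exists_dist_lt ⟨p, by simpa using hp⟩ hδ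
    refine ⟨k, ?_⟩
    rw [← dist_eq_norm, dist_comm]
    exact hk

section ell
variable {d : ℕ} {pk : ℕ → Ed d} {R N μ : ℝ} {F : Ed d → Ed d → ℝ}

lemma ell_bdd (hpk : DenseBall pk R) (hN : 0 ≤ N) (q z : Ed d) :
    BddAbove (Set.range fun k => (⟪pk k, q⟫ - N * ‖q‖ * max (F (pk k) z - μ) 0)) := by
  refine ⟨R * ‖q‖, ?_⟩
  rintro _ ⟨k, rfl⟩
  have h1 := real_inner_le_norm (pk k) q
  have h2 : ‖pk k‖ * ‖q‖ ≤ R * ‖q‖ := by gcongr; exact hpk.1 k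
  have h3 : 0 ≤ N * ‖q‖ * max (F (pk k) z - μ) 0 := by positivity
  simp only
  linarith

lemma term_le_ell (hpk : DenseBall pk R) (hN : 0 ≤ N) (q z : Ed d) (k : ℕ) :
    ⟪pk k, q⟫ - N * ‖q‖ * max (F (pk k) z - μ) 0 ≤ ell pk N μ F q z :=
  le_ciSup (ell_bdd hpk hN q z) k

lemma ell_lip (hpk : DenseBall pk R) (hN : 0 ≤ N) {M : ℝ}
    (hM : ∀ p z, ‖p‖ ≤ R → max (F p z - μ) 0 ≤ M) (q q' z : Ed d) :
    ell pk N μ F q z ≤ ell pk N μ F q' z + (R + N * M) * ‖q - q'‖ := by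
  apply ciSup_le
  intro k
  have h1 := term_le_ell (μ := μ) (F := F) hpk hN q' z k
  have h2 := real_inner_le_norm (pk k) (q - q')
  rw [inner_sub_right] at h2
  have h3 : ‖pk k‖ * ‖q - q'‖ ≤ R * ‖q - q'‖ := by gcongr; exact hpk.1 k
  have h4 := hM (pk k) z (hpk.1 k)
  have h5 : ‖q'‖ - ‖q‖ ≤ ‖q - q'‖ := by rw [norm_sub_rev]; exact norm_sub_norm_le _ _
  have h6 : 0 ≤ max (F (pk k) z - μ) 0 := le_max_right _ _
  have h7 : N * (‖q'‖ - ‖q‖) * max (F (pk k) z - μ) 0 ≤ N * ‖q - q'‖ * M := by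
    calc N * (‖q'‖ - ‖q‖) * max (F (pk k) z - μ) 0
        ≤ N * ‖q - q'‖ * max (F (pk k) z - μ) 0 := by gcongr
      _ ≤ N * ‖q - q'‖ * M := by gcongr
  nlinarith

lemma ell_zero (z : Ed d) : ell pk N μ F 0 z = 0 := by simp [ell]

lemma ell_osc (hpk : DenseBall pk R) (hN : 0 ≤ N) {κ : ℝ} (q z z' : Ed d)
    (hz : ∀ p, ‖p‖ ≤ R → N * |F p z - F p z'| ≤ κ) :
    ell pk N μ F q z ≤ ell pk N μ F q z' + κ * ‖q‖ := by
  apply ciSup_le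
  intro k
  have h1 := term_le_ell (μ := μ) (F := F) hpk hN q z' k
  have h2 := hz (pk k) (hpk.1 k)
  have h3 : max (F (pk k) z' - μ) 0 ≤ max (F (pk k) z - μ) 0 + |F (pk k) z - F (pk k) z'| := by
    apply max_le
    · have := le_max_left (F (pk k) z - μ) 0
      have := neg_abs_le (F (pk k) z - F (pk k) z')
      linarith
    · have := le_max_right (F (pk k) z - μ) 0
      have := abs_nonneg (F (pk k) z - F (pk k) z')
      linarith
  have h4 : N * ‖q‖ * max (F (pk k) z' - μ) 0
      ≤ N * ‖q‖ * (max (F (pk k) z - μ) 0 + |F (pk k) z - F (pk k) z'|) := by gcongr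
  have h5 : ‖q‖ * (N * |F (pk k) z - F (pk k) z'|) ≤ ‖q‖ * κ := by gcongr
  linarith

lemma ell_smul_le (hpk : DenseBall pk R) (hN : 0 ≤ N) {t : ℝ} (ht : 0 ≤ t) (q z : Ed d) :
    ell pk N μ F (t • q) z ≤ t * ell pk N μ F q z := by
  apply ciSup_le
  intro k
  have h1 := term_le_ell (μ := μ) (F := F) hpk hN q z k
  rw [inner_smul_right, norm_smul, Real.norm_of_nonneg ht]
  have := mul_le_mul_of_nonneg_left h1 ht
  linarith

lemma inner_le_ell (hpk : DenseBall pk R) (hN : 0 ≤ N) (q z p : Ed d)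
    (hF : Continuous fun p => F p z) (hp : ‖p‖ ≤ R) (hpF : F p z ≤ μ) :
    ⟪p, q⟫ ≤ ell pk N μ F q z := by
  have hc : Continuous fun p' : Ed d => ⟪p', q⟫ - N * ‖q‖ * max (F p' z - μ) 0 := by fun_prop
  have e : ⟪p, q⟫ - N * ‖q‖ * max (F p z - μ) 0 = ⟪p, q⟫ := by
    rw [max_eq_right (by linarith)]; ring
  rw [← e]
  apply le_of_forall_pos_le_add
  intro η hη
  obtain ⟨δ, hδ, hδv⟩ := Metric.continuous_iff.1 hc p η hη
  obtain ⟨k, hk⟩ := hpk.2 p hp δ hδ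
  have h1 := hδv (pk k) (by rwa [dist_eq_norm])
  rw [Real.dist_eq] at h1
  have h2 := (abs_lt.1 h1).1
  have h3 := term_le_ell (μ := μ) (F := F) hpk hN q z k
  linarith

/-- If `p` is below the regularised support function up to `κ`, then `p` is `κ`-close to the
sublevel set `{F ≤ μ + η}`. -/
lemma exists_near_of_inner_le_ell (hd : 0 < d) (hpk : DenseBall pk R) (hN : 0 ≤ N) {η κ : ℝ}
    (hNη : 2 * R + 1 ≤ N * η) (hη : 0 < η) (hκ0 : 0 ≤ κ) (hκ : κ < R + 1) (hR : 0 ≤ R) (z p : Ed d)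
    (hF : Continuous fun p => F p z)
    (hqc : ∀ p q, F ((1 / 2 : ℝ) • (p + q)) z ≤ max (F p z) (F q z))
    (hcoer : ∀ p, F p z ≤ μ + η → ‖p‖ ≤ R)
    (hp : ∀ q, ⟪p, q⟫ ≤ ell pk N μ F q z + κ * ‖q‖) :
    ∃ p0, ‖p - p0‖ ≤ κ ∧ F p0 z ≤ μ + η := by
  set K : Set (Ed d) := {p | F p z ≤ μ + η} with hK
  -- bound for terms outside `K`
  have hout : ∀ q : Ed d, ∀ k, pk k ∉ K →
      ⟪pk k, q⟫ - N * ‖q‖ * max (F (pk k) z - μ) 0 ≤ -(R + 1) * ‖q‖ := by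
    intro q k hk
    have hk' : μ + η < F (pk k) z := by simpa [hK] using hk
    have h1 := real_inner_le_norm (pk k) q
    have h2 : ‖pk k‖ * ‖q‖ ≤ R * ‖q‖ := by gcongr; exact hpk.1 k
    have h3 : η ≤ max (F (pk k) z - μ) 0 := le_trans (by linarith) (le_max_left _ _)
    have h4 : N * ‖q‖ * η ≤ N * ‖q‖ * max (F (pk k) z - μ) 0 := by gcongr
    have h5 : (2 * R + 1) * ‖q‖ ≤ N * η * ‖q‖ := by gcongr
    nlinarith
  rcases K.eq_empty_or_nonempty with hKe | hKne
  · exfalso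
    have : Nonempty (Fin d) := ⟨⟨0, hd⟩⟩
    obtain ⟨q, hq⟩ : ∃ q : Ed d, q ≠ 0 := exists_ne 0
    have hle : ∀ q : Ed d, ell pk N μ F q z ≤ -(R + 1) * ‖q‖ := by
      intro q
      apply ciSup_le
      intro k
      exact hout q k (by simp [hKe])
    have h1 := hp q
    have h2 := hp (-q)
    have h3 := hle q
    have h4 := hle (-q)
    rw [inner_neg_right] at h2
    rw [norm_neg] at h2 h4
    have : 0 < ‖q‖ := norm_pos_iff.2 hq
    nlinarith
  · have hKclosed : IsClosed K := isClosed_le hF continuous_const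
    have hKcomp : IsCompact K := by
      apply (isCompact_closedBall (0 : Ed d) R).of_isClosed_subset hKclosed
      intro p hp
      simpa using hcoer p hp
    obtain ⟨p0, hp0K, hmin⟩ := hKcomp.exists_isMinOn hKne (f := fun p' => ‖p - p'‖)
      (by apply Continuous.continuousOn; fun_prop)
    have hmin' : ∀ p' ∈ K, ‖p - p0‖ ≤ ‖p - p'‖ := fun p' hp' => hmin hp'
    have hhalf : ∀ p' ∈ K, ∀ n : ℕ, p0 + ((1 / 2 : ℝ) ^ n) • (p' - p0) ∈ K := by
      intro p' hp' n
      induction n with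
      | zero => simpa using hp'
      | succ n ih =>
        have h1 := hqc p0 (p0 + ((1 / 2 : ℝ) ^ n) • (p' - p0))
        have e : (1 / 2 : ℝ) • (p0 + (p0 + ((1 / 2 : ℝ) ^ n) • (p' - p0)))
            = p0 + ((1 / 2 : ℝ) ^ (n + 1)) • (p' - p0) := by
          rw [pow_succ]; module
        rw [e] at h1
        exact h1.trans (max_le hp0K ih)
    have hinner : ∀ p' ∈ K, ⟪p - p0, p' - p0⟫ ≤ 0 := by
      intro p' hp'
      have key : ∀ n : ℕ, 2 * ⟪p - p0, p' - p0⟫ ≤ (1 / 2 : ℝ) ^ n * ‖p' - p0‖ ^ 2 := by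
        intro n
        have h1 := hmin' _ (hhalf p' hp' n)
        have e : p - (p0 + ((1 / 2 : ℝ) ^ n) • (p' - p0))
            = (p - p0) - ((1 / 2 : ℝ) ^ n) • (p' - p0) := by abel
        have hpos : (0 : ℝ) < (1 / 2 : ℝ) ^ n := by positivity
        have h2 : ‖p - p0‖ ^ 2 ≤ ‖(p - p0) - ((1 / 2 : ℝ) ^ n) • (p' - p0)‖ ^ 2 := by
          rw [← e]; gcongr
        rw [norm_sub_sq_real (p - p0), inner_smul_right, norm_smul,
          Real.norm_of_nonneg hpos.le] at h2
        have h3 : (1 / 2 : ℝ) ^ n * (2 * ⟪p - p0, p' - p0⟫)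
            ≤ (1 / 2 : ℝ) ^ n * ((1 / 2 : ℝ) ^ n * ‖p' - p0‖ ^ 2) := by nlinarith
        exact le_of_mul_le_mul_left h3 hpos
      have hlim : Tendsto (fun n : ℕ => (1 / 2 : ℝ) ^ n * ‖p' - p0‖ ^ 2) atTop (𝓝 (0 * ‖p' - p0‖ ^ 2)) :=
        (tendsto_pow_atTop_nhds_zero_of_lt_one (by norm_num) (by norm_num)).mul_const _
      rw [zero_mul] at hlim
      have := ge_of_tendsto' hlim key
      linarith
    refine ⟨p0, ?_, hp0K⟩
    have hp0R := hcoer p0 hp0K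
    have hell : ell pk N μ F (p - p0) z ≤ ⟪p0, p - p0⟫ := by
      apply ciSup_le
      intro k
      by_cases hk : pk k ∈ K
      · have h1 := hinner _ hk
        rw [real_inner_comm, inner_sub_left] at h1
        have : 0 ≤ N * ‖p - p0‖ * max (F (pk k) z - μ) 0 := by positivity
        linarith
      · have h1 := hout (p - p0) k hk
        have h2 := neg_le_of_abs_le (abs_real_inner_le_norm p0 (p - p0))
        have h3 : ‖p0‖ * ‖p - p0‖ ≤ R * ‖p - p0‖ := by gcongr
        nlinarith [norm_nonneg (p - p0)]
    have h1 := hp (p - p0)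
    have h2 : ⟪p, p - p0⟫ = ‖p - p0‖ ^ 2 + ⟪p0, p - p0⟫ := by
      rw [← real_inner_self_eq_norm_sq, ← inner_add_left, sub_add_cancel]
    have h3 : ‖p - p0‖ ^ 2 ≤ κ * ‖p - p0‖ := by linarith
    by_contra hcon
    push Not at hcon
    nlinarith [norm_nonneg (p - p0)]

end ell

/-! ### Comparison of a supersolution with a sublinear function having controlled increments -/

lemma comparison_at_zero {d : ℕ} {pk : ℕ → Ed d} {R N μ : ℝ} {F : Ed d → Ed d → ℝ}
    (hd : 0 < d) (hpk : DenseBall pk R) (hN : 0 ≤ N) {η κ : ℝ}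
    (hNη : 2 * R + 1 ≤ N * η) (hη : 0 < η) (hκ0 : 0 < κ) (hκ : 3 * κ < 1) (hR : 0 ≤ R)
    (hF : ∀ z, Continuous fun p => F p z)
    (hqc : ∀ p q z, F ((1 / 2 : ℝ) • (p + q)) z ≤ max (F p z) (F q z))
    (hcoer : ∀ p z, F p z ≤ μ + η → ‖p‖ ≤ R)
    {θ : ℝ} (hθ : 0 < θ)
    (hUC : ∀ p p' y y', ‖p‖ ≤ R + 1 → ‖p'‖ ≤ R + 1 → ‖p - p'‖ ≤ 3 * κ → ‖y - y'‖ ≤ θ →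
      F p y ≤ F p' y' + η)
    {ε : ℝ} (hε : 0 < ε) {v : Ed d → ℝ} (hsup : QSuper d F ε v) (hv : Continuous v)
    {L M : ℝ} (hL : 0 ≤ L) (hvL : ∀ x y, v x ≤ v y + L * ‖x - y‖) (hM : ∀ x, |v x| ≤ M)
    {w : Ed d → ℝ} (hw : Continuous w) {h C : ℝ} (hh : 0 < h)
    (hinc : ∀ z q, ‖q‖ < h → w z ≤ w (z + q) + (ell pk N μ F (-q) z + κ * ‖q‖))
    (hw0 : 0 ≤ w 0) (hwC : ∀ y, w y ≤ κ * ‖y‖ + C) :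
    -μ - 2 * η - ε * C ≤ ε * v 0 := by
  have hM0 : 0 ≤ M := (abs_nonneg _).trans (hM 0)
  set α : ℝ := L / θ + 1 with hα
  have hαpos : 0 < α := by positivity
  set Φ : Ed d × Ed d → ℝ := fun x => v x.1 - w x.2 + 2 * κ * ‖x.2‖ + α * ‖x.1 - x.2‖ ^ 2 with hΦ
  have hΦc : Continuous Φ := by fun_prop
  obtain ⟨⟨x1, y1⟩, hmin⟩ : ∃ x, ∀ y, Φ x ≤ Φ y := by
    apply hΦc.exists_forall_le' (0, 0)
    set m : ℝ := min κ α with hm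
    have hmpos : 0 < m := lt_min hκ0 hαpos
    have hmκ : m ≤ κ := min_le_left _ _
    have hmα : m ≤ α := min_le_right _ _
    set T : ℝ := 2 + 2 * (2 * M + |C|) / m with hT
    have hT2 : 2 ≤ T := by
      have : 0 ≤ 2 * (2 * M + |C|) / m := by positivity
      linarith
    have hmT : 2 * M + |C| ≤ m * (T / 2) := by
      have : m * (T / 2) = m + (2 * M + |C|) := by rw [hT]; field_simp
      linarith
    filter_upwards [(tendsto_norm_cocompact_atTop (E := Ed d × Ed d)).eventually_ge_atTop T]
      with x hx
    obtain ⟨x, y⟩ := x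
    simp only [hΦ]
    have a1 := abs_le.1 (hM x)
    have a2 := abs_le.1 (hM 0)
    have a3 := hwC y
    have a4 := le_abs_self C
    have key : m * (T / 2) ≤ κ * ‖y‖ + α * ‖x - y‖ ^ 2 := by
      by_cases hy : T / 2 ≤ ‖y‖
      · have h1 : m * (T / 2) ≤ κ * ‖y‖ := by gcongr
        have h2 : 0 ≤ α * ‖x - y‖ ^ 2 := by positivity
        linarith
      · push Not at hy
        have hx' : T ≤ ‖x‖ := by
          rcases le_max_iff.1 (show T ≤ max ‖x‖ ‖y‖ from hx) with h1 | h1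
          · exact h1
          · linarith
        have h3 : T / 2 ≤ ‖x - y‖ := by
          have := norm_sub_norm_le x y
          linarith
        have h4 : T / 2 ≤ ‖x - y‖ ^ 2 := by nlinarith
        have h1 : m * (T / 2) ≤ α * ‖x - y‖ ^ 2 := by gcongr
        have h2 : 0 ≤ κ * ‖y‖ := by positivity
        linarith
    simp only [norm_zero, sub_self]
    nlinarith
  have hmin' : ∀ x y, Φ (x1, y1) ≤ Φ (x, y) := fun x y => hmin (x, y)
  simp only [hΦ] at hmin'
  set p : Ed d := (2 * α) • (y1 - x1) with hp
  -- closeness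
  have hclose : ‖x1 - y1‖ ≤ θ := by
    have h1 := hmin' y1 y1
    simp only [sub_self, norm_zero] at h1
    have h2 := hvL y1 x1
    rw [norm_sub_rev] at h2
    have h3 : α * ‖x1 - y1‖ ^ 2 ≤ L * ‖x1 - y1‖ := by norm_num at h1; linarith
    by_contra hcon
    push Not at hcon
    have h4 : α * ‖x1 - y1‖ ≤ L := by
      have : 0 < ‖x1 - y1‖ := hθ.trans hcon
      nlinarith
    have h5 : L + θ = α * θ := by rw [hα]; field_simp
    nlinarith
  -- supersolution test
  have hS : 0 ≤ ε * v x1 + F p x1 := by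
    have h1 := hsup (-α) y1 x1 ?_
    · have : (2 * -α) • (x1 - y1) = p := by rw [hp]; module
      rwa [this] at h1
    · apply Eventually.of_forall
      intro x
      have := hmin' x y1
      simp only
      linarith
  -- increments of w
  have hpq : ∀ q, ⟪p, q⟫ ≤ ell pk N μ F q y1 + (3 * κ) * ‖q‖ := by
    intro q
    have key : ∀ t : ℝ, 0 < t → t * ‖q‖ < h →
        ⟪p, q⟫ ≤ ell pk N μ F q y1 + (3 * κ) * ‖q‖ + t * (α * ‖q‖ ^ 2) := by
      intro t ht hth
      have hn : ‖-(t • q)‖ = t * ‖q‖ := by rw [norm_neg, norm_smul, Real.norm_of_nonneg ht.le]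
      have h1 := hinc y1 (-(t • q)) (by rwa [hn])
      have h2 := hmin' x1 (y1 + -(t • q))
      have h3 := norm_add_le y1 (-(t • q))
      rw [hn] at h1 h3
      rw [neg_neg] at h1
      have h4 := ell_smul_le (μ := μ) (F := F) hpk hN ht.le q y1
      have e : x1 - (y1 + -(t • q)) = (x1 - y1) + t • q := by abel
      rw [e, norm_add_sq_real, inner_smul_right, norm_smul, Real.norm_of_nonneg ht.le] at h2
      have e2 : ⟪p, q⟫ = - (2 * α * ⟪x1 - y1, q⟫) := by
        rw [hp, inner_smul_left, ← neg_sub x1 y1, inner_neg_left]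
        simp
      rw [e2]
      have h5 : 2 * κ * ‖y1 + -(t • q)‖ ≤ 2 * κ * (‖y1‖ + t * ‖q‖) := by gcongr
      have h6 : t * -(2 * α * ⟪x1 - y1, q⟫) ≤
          t * (ell pk N μ F q y1 + (3 * κ) * ‖q‖ + t * (α * ‖q‖ ^ 2)) := by
        nlinarith
      exact le_of_mul_le_mul_left h6 ht
    apply le_of_forall_pos_le_add
    intro s hs
    have hev : ∀ᶠ t : ℝ in 𝓝[>] 0, t * ‖q‖ < h ∧ t * (α * ‖q‖ ^ 2) < s := by
      have c1 : Tendsto (fun t : ℝ => t * ‖q‖) (𝓝 0) (𝓝 (0 * ‖q‖)) :=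
        (continuous_id.mul continuous_const).tendsto 0
      have c2 : Tendsto (fun t : ℝ => t * (α * ‖q‖ ^ 2)) (𝓝 0) (𝓝 (0 * (α * ‖q‖ ^ 2))) :=
        (continuous_id.mul continuous_const).tendsto 0
      rw [zero_mul] at c1 c2
      exact nhdsWithin_le_nhds ((c1.eventually_lt_const hh).and (c2.eventually_lt_const hs))
    obtain ⟨t, ⟨ht1, ht2⟩, ht0⟩ := (hev.and self_mem_nhdsWithin).exists
    have := key t ht0 ht1
    linarith
  obtain ⟨p0, hp0, hFp0⟩ := exists_near_of_inner_le_ell hd hpk hN hNη hη (by positivity)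
    (by linarith) hR y1 p (hF y1) (fun p q => hqc p q y1) (fun p => hcoer p y1) hpq
  have hp0R := hcoer p0 y1 hFp0
  have hpR : ‖p‖ ≤ R + 1 := by
    have := norm_add_le p0 (p - p0)
    rw [add_sub_cancel] at this
    linarith
  have h1 := hUC p p0 x1 y1 hpR (by linarith) hp0 hclose
  have h2 := hmin' 0 0
  simp only [sub_self, norm_zero] at h2
  have h3 := hwC y1
  have h4 : 0 ≤ α * ‖x1 - y1‖ ^ 2 := by positivity
  have h5 : v x1 - C ≤ v 0 := by
    have : 0 ≤ κ * ‖y1‖ := by positivity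
    nlinarith
  have h6 := mul_le_mul_of_nonneg_left h5 hε.le
  linarith

/-! ### A maximal inequality and a density lemma -/

open Classical in
lemma greedy_maximal {α : ℝ} (hα : 0 < α) (N : ℕ) (m : ℕ) : ∀ (c : ℕ → ℝ), (∀ i, 0 ≤ c i) →
    α * ∑ k ∈ Finset.range m,
      (if ∃ n, 1 ≤ n ∧ n ≤ N ∧ α * n < ∑ i ∈ Finset.range n, c (k + i) then (1 : ℝ) else 0)
      ≤ ∑ k ∈ Finset.range (m + N), c k := by
  induction m using Nat.strong_induction_on with
  | _ m ih =>
    intro c hc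
    rcases Nat.eq_zero_or_pos m with rfl | hm
    · simpa using Finset.sum_nonneg (fun i _ => hc i)
    set X : ℕ → ℝ := fun k =>
      (if ∃ n, 1 ≤ n ∧ n ≤ N ∧ α * n < ∑ i ∈ Finset.range n, c (k + i) then (1 : ℝ) else 0) with hX
    have hX0 : ∀ k, 0 ≤ X k := by intro k; simp only [hX]; split_ifs <;> norm_num
    have hX1 : ∀ k, X k ≤ 1 := by intro k; simp only [hX]; split_ifs <;> norm_num
    change α * ∑ k ∈ Finset.range m, X k ≤ _
    -- the common step
    have step : ∀ n, 1 ≤ n → n ≤ m + N → α * ∑ k ∈ Finset.range n, X k ≤ ∑ i ∈ Finset.range n, c i →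
        n ≤ m → α * ∑ k ∈ Finset.range m, X k ≤ ∑ k ∈ Finset.range (m + N), c k := by
      intro n hn1 hnN hle hnm
      have h1 := ih (m - n) (by omega) (fun i => c (n + i)) (fun i => hc _)
      have e1 : m = n + (m - n) := by omega
      have e2 : m + N = n + (m - n + N) := by omega
      have e3 : ∑ k ∈ Finset.range m, X k
          = ∑ k ∈ Finset.range n, X k + ∑ k ∈ Finset.range (m - n), X (n + k) := by
        conv_lhs => rw [e1, Finset.sum_range_add]
      have e4 : ∑ k ∈ Finset.range (m + N), c k
          = ∑ k ∈ Finset.range n, c k + ∑ k ∈ Finset.range (m - n + N), c (n + k) := by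
        rw [e2, Finset.sum_range_add]
      rw [e3, e4, mul_add]
      refine add_le_add hle ?_
      refine le_trans (le_of_eq ?_) h1
      congr 1
      apply Finset.sum_congr rfl
      intro k _
      simp only [hX, add_assoc]
    by_cases h0 : ∃ n, 1 ≤ n ∧ n ≤ N ∧ α * n < ∑ i ∈ Finset.range n, c (0 + i)
    · obtain ⟨n, hn1, hnN, hlt⟩ := h0
      simp only [zero_add] at hlt
      by_cases hnm : n ≤ m
      · apply step n hn1 (by omega) _ hnm
        have : ∑ k ∈ Finset.range n, X k ≤ n := by
          simpa using Finset.sum_le_sum (fun k (_ : k ∈ Finset.range n) => hX1 k)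
        nlinarith
      · have h1 : ∑ k ∈ Finset.range m, X k ≤ m := by
          simpa using Finset.sum_le_sum (fun k (_ : k ∈ Finset.range m) => hX1 k)
        have h2 : ∑ k ∈ Finset.range n, c k ≤ ∑ k ∈ Finset.range (m + N), c k :=
          Finset.sum_le_sum_of_subset_of_nonneg (by
            intro x hx; simp only [Finset.mem_range] at *; omega) (fun i _ _ => hc i)
        have h3 : (m : ℝ) ≤ n := by exact_mod_cast (not_le.1 hnm).le
        nlinarith
    · apply step 1 le_rfl (by omega) _ hm
      have : X 0 = 0 := by simp only [hX]; rw [if_neg h0]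
      simp [this, hc 0]

lemma measurableSet_maximal {Ω : Type*} [MeasurableSpace Ω] {T : Ω → Ω} (hT : Measurable T)
    {A : Set Ω} (hA : MeasurableSet A) (α : ℝ) (n : ℕ) :
    MeasurableSet {ω | α * n < ∑ i ∈ Finset.range n, A.indicator (fun _ => (1 : ℝ)) (T^[i] ω)} := by
  apply measurableSet_lt measurable_const
  apply Finset.measurable_sum
  intro i _
  exact (measurable_const.indicator hA).comp (hT.iterate i)

/-- The set where the maximal function exceeds `α`. -/
def MaxSet {Ω : Type*} (T : Ω → Ω) (A : Set Ω) (α : ℝ) : Set Ω :=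
  {ω | ∃ n : ℕ, 1 ≤ n ∧ α * n < ∑ i ∈ Finset.range n, A.indicator (fun _ => (1 : ℝ)) (T^[i] ω)}

lemma measurableSet_MaxSet {Ω : Type*} [MeasurableSpace Ω] {T : Ω → Ω} (hT : Measurable T)
    {A : Set Ω} (hA : MeasurableSet A) (α : ℝ) : MeasurableSet (MaxSet T A α) := by
  have : MaxSet T A α = ⋃ n : ℕ, ⋃ _ : 1 ≤ n,
      {ω | α * n < ∑ i ∈ Finset.range n, A.indicator (fun _ => (1 : ℝ)) (T^[i] ω)} := by
    ext ω; simp [MaxSet]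
  rw [this]
  exact MeasurableSet.iUnion fun n => MeasurableSet.iUnion fun _ => measurableSet_maximal hT hA α n

open Classical in
lemma maximal_ineq {Ω : Type*} [MeasurableSpace Ω] {P : Measure Ω} [IsProbabilityMeasure P]
    {T : Ω → Ω} (hT : MeasurePreserving T P P) {A : Set Ω} (hA : MeasurableSet A) {α : ℝ}
    (hα : 0 < α) : P.real (MaxSet T A α) ≤ P.real A / α := by
  set f : Ω → ℝ := A.indicator (fun _ => (1 : ℝ)) with hf
  set X : ℕ → Set Ω := fun N => {ω | ∃ n : ℕ, 1 ≤ n ∧ n ≤ N ∧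
    α * n < ∑ i ∈ Finset.range n, f (T^[i] ω)} with hX
  have hXm : ∀ N, MeasurableSet (X N) := by
    intro N
    have : X N = ⋃ n : ℕ, ⋃ _ : 1 ≤ n, ⋃ _ : n ≤ N,
        {ω | α * n < ∑ i ∈ Finset.range n, A.indicator (fun _ => (1 : ℝ)) (T^[i] ω)} := by
      ext ω
      simp only [hX, hf, Set.mem_iUnion, exists_prop]
      rfl
    rw [this]
    exact MeasurableSet.iUnion fun n => MeasurableSet.iUnion fun _ => MeasurableSet.iUnion fun _ =>
      measurableSet_maximal hT.measurable hA α n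
  have hmono : Monotone X := by
    intro a b hab ω hω
    obtain ⟨n, h1, h2, h3⟩ := hω
    exact ⟨n, h1, h2.trans hab, h3⟩
  have hun : MaxSet T A α = ⋃ N, X N := by
    ext ω
    simp only [MaxSet, hX, Set.mem_setOf_eq, Set.mem_iUnion]
    constructor
    · rintro ⟨n, h1, h2⟩; exact ⟨n, n, h1, le_rfl, h2⟩
    · rintro ⟨_, n, h1, _, h2⟩; exact ⟨n, h1, h2⟩
  have hintg : ∀ (B : Set Ω), MeasurableSet B → ∀ k : ℕ,
      Integrable (fun ω => B.indicator (fun _ => (1 : ℝ)) (T^[k] ω)) P ∧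
      ∫ ω, B.indicator (fun _ => (1 : ℝ)) (T^[k] ω) ∂P = P.real B := by
    intro B hB k
    have hk := hT.iterate k
    have hi : Integrable (B.indicator (fun _ => (1 : ℝ))) P :=
      (integrable_const (1 : ℝ)).indicator hB
    refine ⟨hk.integrable_comp_of_integrable hi, ?_⟩
    have := integral_map (μ := P) hk.measurable.aemeasurable
      (f := B.indicator (fun _ => (1 : ℝ))) (by rw [hk.map_eq]; exact hi.aestronglyMeasurable)
    rw [hk.map_eq] at this
    rw [← this, integral_indicator hB]
    simp
  have hXN : ∀ N, P.real (X N) ≤ P.real A / α := by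
    intro N
    have key : ∀ m : ℕ, α * (m * P.real (X N)) ≤ (m + N : ℕ) * P.real A := by
      intro m
      have h1 : ∫ ω, α * ∑ k ∈ Finset.range m, (X N).indicator (fun _ => (1 : ℝ)) (T^[k] ω) ∂P
          ≤ ∫ ω, ∑ k ∈ Finset.range (m + N), f (T^[k] ω) ∂P := by
        apply integral_mono
        · exact (integrable_finsetSum _ fun k _ => (hintg _ (hXm N) k).1).const_mul α
        · exact integrable_finsetSum _ fun k _ => (hintg _ hA k).1
        · intro ω
          have := greedy_maximal hα N m (fun i => f (T^[i] ω))
            (fun i => Set.indicator_nonneg (fun _ _ => zero_le_one) _)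
          refine le_trans (le_of_eq ?_) this
          simp only
          congr 1
          apply Finset.sum_congr rfl
          intro k _
          simp only [Set.indicator_apply]
          apply if_congr _ rfl rfl
          simp only [hX, Set.mem_setOf_eq]
          apply exists_congr
          intro n
          have : ∀ i, T^[i] (T^[k] ω) = T^[k + i] ω := by
            intro i; rw [add_comm, Function.iterate_add_apply]
          simp only [this]
      rw [integral_const_mul, integral_finsetSum _ (fun k _ => (hintg _ (hXm N) k).1),
        integral_finsetSum _ (fun k _ => (hintg _ hA k).1)] at h1
      simp only [hf, (hintg _ (hXm N) _).2, (hintg _ hA _).2, Finset.sum_const, Finset.card_range,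
        nsmul_eq_mul] at h1
      exact h1
    rw [le_div_iff₀ hα]
    by_contra hcon
    push Not at hcon
    have hδ : 0 < P.real (X N) * α - P.real A := by linarith
    obtain ⟨m, hm⟩ := exists_nat_gt (N * P.real A / (P.real (X N) * α - P.real A))
    rw [div_lt_iff₀ hδ] at hm
    have := key m
    push_cast at this
    nlinarith
  rw [hun]
  have ht : Tendsto (fun N => P.real (X N)) atTop (𝓝 (P.real (⋃ N, X N))) := by
    have := tendsto_measure_iUnion_atTop (μ := P) hmono
    exact (ENNReal.tendsto_toReal (measure_ne_top _ _)).comp this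
  exact le_of_tendsto' ht hXN

lemma notMem_of_not_maxSet {Ω : Type*} {T : Ω → Ω} {A : Set Ω} {ρ K R t : ℝ} (hρ : 0 < ρ)
    (hK : 0 < K) {ω : Ω} (hω : ω ∉ MaxSet T A (ρ / (4 * (K + ρ + 1)))) (hR1 : 1 ≤ R)
    (hR : 2 / ρ ≤ R) (ht0 : 0 ≤ t) (ht : t ≤ K * R) :
    ∃ n : ℕ, |(n : ℝ) - t| ≤ ρ * R ∧ T^[n] ω ∉ A := by
  by_contra hcon
  push Not at hcon
  rw [div_le_iff₀ hρ] at hR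
  apply hω
  have hpos : 0 ≤ t + ρ * R := by positivity
  refine ⟨⌊t + ρ * R⌋₊ + 1, by omega, ?_⟩
  set n := ⌊t + ρ * R⌋₊ + 1 with hn
  have hn1 : t + ρ * R < n := by rw [hn]; push_cast; exact Nat.lt_floor_add_one _
  have hn2 : (n : ℝ) ≤ t + ρ * R + 1 := by
    rw [hn]; push_cast; linarith [Nat.floor_le hpos]
  have hc1 : (⌈t⌉₊ : ℝ) < t + 1 := Nat.ceil_lt_add_one ht0
  have hcn : ⌈t⌉₊ ≤ n := by
    have : (⌈t⌉₊ : ℝ) < n := by nlinarith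
    exact_mod_cast this.le
  have h1 : ((n : ℝ) - ⌈t⌉₊) ≤ ∑ i ∈ Finset.range n, A.indicator (fun _ => (1 : ℝ)) (T^[i] ω) := by
    have h2 : ∑ i ∈ Finset.Ico ⌈t⌉₊ n, (1 : ℝ) ≤
        ∑ i ∈ Finset.range n, A.indicator (fun _ => (1 : ℝ)) (T^[i] ω) := by
      refine le_trans (Finset.sum_le_sum (g := fun i =>
        A.indicator (fun _ => (1 : ℝ)) (T^[i] ω)) ?_) (Finset.sum_le_sum_of_subset_of_nonneg ?_ ?_)
      · intro i hi
        rw [Finset.mem_Ico] at hi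
        have hi1 : t ≤ i := Nat.ceil_le.1 hi.1
        have hi2 : (i : ℝ) ≤ t + ρ * R := by
          have : i ≤ ⌊t + ρ * R⌋₊ := by omega
          exact (Nat.le_floor_iff hpos).1 this
        rw [Set.indicator_of_mem (hcon i (by rw [abs_le]; constructor <;> linarith))]
      · intro i hi; simp only [Finset.mem_Ico, Finset.mem_range] at *; omega
      · intro i _ _; exact Set.indicator_nonneg (fun _ _ => zero_le_one) _
    simpa [Nat.cast_sub hcn] using h2
  refine lt_of_lt_of_le ?_ h1
  have hD : 0 < 4 * (K + ρ + 1) := by positivity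
  rw [div_mul_eq_mul_div, div_lt_iff₀ hD]
  have h3 : (n : ℝ) ≤ (K + ρ + 1) * R := by nlinarith
  have h4 : ρ * n ≤ ρ * ((K + ρ + 1) * R) := by gcongr
  have h5 : ρ * R / 2 ≤ n - ⌈t⌉₊ := by linarith
  have h6 : ρ * R / 2 * (4 * (K + ρ + 1)) ≤ (n - ⌈t⌉₊) * (4 * (K + ρ + 1)) := by gcongr
  have h7 : 0 < ρ * R * (K + ρ + 1) := by positivity
  nlinarith

lemma iterate_tau {d : ℕ} {Ω : Type*} {τ : Ed d → Ω → Ω}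
    (hτgrp : ∀ x y : Ed d, τ (x + y) = τ x ∘ τ y) (hτzero : τ 0 = id) (e : Ed d) (n : ℕ) :
    (τ e)^[n] = τ ((n : ℝ) • e) := by
  induction n with
  | zero => simp [hτzero]
  | succ n ih =>
    rw [Function.iterate_succ', ih, ← hτgrp]
    congr 1
    push_cast
    rw [add_smul, one_smul, add_comm]

lemma density {d : ℕ} {Ω : Type*} [MeasurableSpace Ω] {P : Measure Ω} [IsProbabilityMeasure P]
    {τ : Ed d → Ω → Ω} (hτmp : ∀ y : Ed d, MeasurePreserving (τ y) P P)
    (hτgrp : ∀ x y : Ed d, τ (x + y) = τ x ∘ τ y) (hτzero : τ 0 = id) {ρ K : ℝ} (hρ : 0 < ρ)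
    (hK : 0 < K) (s : Finset (Fin d)) : ∀ (X : ℕ → Set Ω), (∀ j, MeasurableSet (X j)) →
    Tendsto (fun j => P.real (X j)) atTop (𝓝 0) →
    ∀ᵐ ω ∂P, ∃ j, ∃ R1 : ℝ, 0 < R1 ∧ ∀ R, R1 ≤ R → ∀ t : Fin d → ℝ, (∀ i, |t i| ≤ K * R) →
      ∃ k : Fin d → ℤ, (∀ i ∈ s, |(k i : ℝ) - t i| ≤ ρ * R) ∧
        τ (∑ i ∈ s, (k i : ℝ) • EuclideanSpace.single i (1 : ℝ)) ω ∉ X j := by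
  induction s using Finset.induction_on with
  | empty =>
    intro X hXm hX
    have h0 : P (⋂ j, X j) = 0 := by
      have h1 : ∀ j, P.real (⋂ j, X j) ≤ P.real (X j) := fun j =>
        measureReal_mono (Set.iInter_subset _ j)
      have h2 : P.real (⋂ j, X j) ≤ 0 := ge_of_tendsto' hX h1
      have h3 : P.real (⋂ j, X j) = 0 := le_antisymm h2 measureReal_nonneg
      rwa [measureReal_eq_zero_iff] at h3
    have h4 : ∀ᵐ ω ∂P, ω ∉ ⋂ j, X j := measure_eq_zero_iff_ae_notMem.1 h0
    filter_upwards [h4] with ω hω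
    simp only [Set.mem_iInter, not_forall] at hω
    obtain ⟨j, hj⟩ := hω
    refine ⟨j, 1, one_pos, fun R _ t _ => ⟨fun _ => 0, by simp, ?_⟩⟩
    simpa [hτzero] using hj
  | insert i s hi ih =>
    intro X hXm hX
    set α := ρ / (4 * (K + ρ + 1)) with hα
    have hαpos : 0 < α := by positivity
    set e : Ed d := EuclideanSpace.single i (1 : ℝ) with he
    set X' : ℕ → Set Ω := fun j => MaxSet (τ e) (X j) α ∪ MaxSet (τ (-e)) (X j) α with hX'
    have hX'm : ∀ j, MeasurableSet (X' j) := fun j =>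
      (measurableSet_MaxSet (hτmp _).measurable (hXm j) α).union
        (measurableSet_MaxSet (hτmp _).measurable (hXm j) α)
    have hX'0 : Tendsto (fun j => P.real (X' j)) atTop (𝓝 0) := by
      have hb : ∀ j, P.real (X' j) ≤ P.real (X j) / α + P.real (X j) / α := fun j =>
        (measureReal_union_le _ _).trans (add_le_add (maximal_ineq (hτmp _) (hXm j) hαpos)
          (maximal_ineq (hτmp _) (hXm j) hαpos))
      have ht : Tendsto (fun j => P.real (X j) / α + P.real (X j) / α) atTop (𝓝 0) := by
        simpa using (hX.div_const α).add (hX.div_const α)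
      exact squeeze_zero (fun _ => measureReal_nonneg) hb ht
    filter_upwards [ih X' hX'm hX'0] with ω hω
    obtain ⟨j, R1, hR1, hω⟩ := hω
    refine ⟨j, max R1 (max 1 (2 / ρ)), lt_max_of_lt_left hR1, fun R hR t ht => ?_⟩
    have hRa : R1 ≤ R := (le_max_left _ _).trans hR
    have hRb : 1 ≤ R := (le_max_left _ _).trans ((le_max_right _ _).trans hR)
    have hRc : 2 / ρ ≤ R := (le_max_right _ _).trans ((le_max_right _ _).trans hR)
    obtain ⟨k, hk, hkω⟩ := hω R hRa t ht
    set z := ∑ i ∈ s, (k i : ℝ) • (EuclideanSpace.single i (1 : ℝ) : Ed d) with hz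
    simp only [hX', Set.mem_union, not_or] at hkω
    have hmain : ∃ m : ℤ, |(m : ℝ) - t i| ≤ ρ * R ∧ τ ((m : ℝ) • e) (τ z ω) ∉ X j := by
      rcases le_total 0 (t i) with h0 | h0
      · obtain ⟨n, hn1, hn2⟩ := notMem_of_not_maxSet hρ hK hkω.1 hRb hRc h0
          ((le_abs_self _).trans (ht i))
        rw [iterate_tau hτgrp hτzero] at hn2
        exact ⟨n, by simpa using hn1, by simpa using hn2⟩
      · obtain ⟨n, hn1, hn2⟩ := notMem_of_not_maxSet hρ hK hkω.2 hRb hRc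
          (t := - t i) (by linarith) ((neg_le_abs _).trans (ht i))
        rw [iterate_tau hτgrp hτzero] at hn2
        refine ⟨-n, ?_, by simpa using hn2⟩
        push_cast
        rw [← abs_neg]
        convert hn1 using 2
        ring
    obtain ⟨m, hm1, hm2⟩ := hmain
    refine ⟨Function.update k i m, ?_, ?_⟩
    · intro l hl
      rcases Finset.mem_insert.1 hl with rfl | hl
      · simpa using hm1
      · have : l ≠ i := fun h => hi (h ▸ hl)
        rw [Function.update_of_ne this]
        exact hk l hl
    · rw [Finset.sum_insert hi]
      have : ∑ x ∈ s, ((Function.update k i m x : ℤ) : ℝ) •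
          (EuclideanSpace.single x (1 : ℝ) : Ed d) = z := by
        rw [hz]
        apply Finset.sum_congr rfl
        intro l hl
        have : l ≠ i := fun h => hi (h ▸ hl)
        rw [Function.update_of_ne this]
      rw [this, Function.update_self, hτgrp]
      exact hm2

/-- Final form of the density lemma. -/
lemma density' {d : ℕ} {Ω : Type*} [MeasurableSpace Ω] {P : Measure Ω} [IsProbabilityMeasure P]
    {τ : Ed d → Ω → Ω} (hτmp : ∀ y : Ed d, MeasurePreserving (τ y) P P)
    (hτgrp : ∀ x y : Ed d, τ (x + y) = τ x ∘ τ y) (hτzero : τ 0 = id) {ρ K : ℝ} (hρ : 0 < ρ)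
    (hK : 0 < K) (X : ℕ → Set Ω) (hXm : ∀ j, MeasurableSet (X j))
    (hX : Tendsto (fun j => P.real (X j)) atTop (𝓝 0)) :
    ∀ᵐ ω ∂P, ∃ j, ∃ R1 : ℝ, 0 < R1 ∧ ∀ R, R1 ≤ R → ∀ x : Ed d, ‖x‖ ≤ K * R →
      ∃ z : Ed d, ‖z - x‖ ≤ ρ * R ∧ τ z ω ∉ X j := by
  have hρ' : 0 < ρ / (d + 1) := by positivity
  filter_upwards [density hτmp hτgrp hτzero hρ' hK Finset.univ X hXm hX] with ω hω
  obtain ⟨j, R1, hR1, hω⟩ := hω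
  refine ⟨j, R1, hR1, fun R hR x hx => ?_⟩
  obtain ⟨k, hk, hkω⟩ := hω R hR (fun i => x i) (fun i => (PiLp.norm_apply_le x i).trans hx)
  refine ⟨_, ?_, hkω⟩
  have hx' : x = ∑ i, x i • (EuclideanSpace.single i (1 : ℝ) : Ed d) := by
    ext j
    simp [Finset.sum_apply, Pi.single_apply]
  have : ∑ i, (k i : ℝ) • (EuclideanSpace.single i (1 : ℝ) : Ed d) - x
      = ∑ i, ((k i : ℝ) - x i) • (EuclideanSpace.single i (1 : ℝ) : Ed d) := by
    conv_lhs => rw [hx']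
    rw [← Finset.sum_sub_distrib]
    simp only [sub_smul]
  rw [this]
  refine (norm_sum_le _ _).trans ?_
  have h1 : ∀ i ∈ Finset.univ, ‖((k i : ℝ) - x i) • (EuclideanSpace.single i (1 : ℝ) : Ed d)‖
      ≤ ρ / (d + 1) * R := by
    intro i hi
    rw [norm_smul]
    simpa using hk i hi
  refine (Finset.sum_le_sum h1).trans ?_
  have hR0 : 0 < R := hR1.trans_le hR
  simp only [Finset.sum_const, Finset.card_univ, Fintype.card_fin, nsmul_eq_mul]
  have : (d : ℝ) * (ρ / (d + 1) * R) = ρ * R * (d / (d + 1)) := by field_simp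
  rw [this]
  have h2 : (d : ℝ) / (d + 1) ≤ 1 := by rw [div_le_one (by positivity)]; linarith
  have h3 : 0 < ρ * R := by positivity
  nlinarith

/-! ### Chains -/

/-- Embedding of rational vectors. -/
def iot {d : ℕ} (r : Fin d → ℚ) : Ed d := WithLp.toLp 2 (fun i => (r i : ℝ))

lemma iot_add {d : ℕ} (r s : Fin d → ℚ) : iot (r + s) = iot r + iot s := by
  ext i; simp [iot]

lemma iot_zero {d : ℕ} : iot (0 : Fin d → ℚ) = 0 := by
  ext i; simp [iot]

lemma iot_neg {d : ℕ} (r : Fin d → ℚ) : iot (-r) = -iot r := by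
  ext i; simp [iot]

lemma iot_sub {d : ℕ} (r s : Fin d → ℚ) : iot (r - s) = iot r - iot s := by
  ext i; simp [iot]

lemma iot_nsmul {d : ℕ} (n : ℕ) (r : Fin d → ℚ) : iot (n • r) = (n : ℝ) • iot r := by
  ext i; simp [iot]

lemma iot_smul {d : ℕ} (c : ℚ) (r : Fin d → ℚ) : iot (c • r) = (c : ℝ) • iot r := by
  ext i; simp [iot]

lemma iot_injective {d : ℕ} : Function.Injective (iot (d := d)) := by
  intro r s h
  funext i
  have : iot r i = iot s i := by rw [h]
  simpa [iot] using this

lemma iot_dense {d : ℕ} : DenseRange (iot (d := d)) := by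
  have h1 : DenseRange (fun r : Fin d → ℚ => fun i => (r i : ℝ)) :=
    DenseRange.piMap (f := fun (_ : Fin d) (q : ℚ) => (q : ℝ)) (fun _ => Rat.denseRange_cast)
  have h2 : DenseRange (WithLp.toLp 2 : (Fin d → ℝ) → Ed d) :=
    (WithLp.toLp_surjective 2).denseRange
  exact h2.comp h1 (PiLp.continuous_toLp 2 _)

/-- Cost of a chain started at `z`. -/
def cost {d : ℕ} (b : Ed d → Ed d → ℝ) : Ed d → List (Fin d → ℚ) → ℝ
  | _, [] => 0
  | z, r :: l => b z (iot r) + cost b (z + iot r) l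

/-- Total length of a chain. -/
def len {d : ℕ} : List (Fin d → ℚ) → ℝ
  | [] => 0
  | r :: l => ‖(iot r : Ed d)‖ + len l

/-- Chains with small steps. -/
def OK {d : ℕ} (h : ℝ) (l : List (Fin d → ℚ)) : Prop := ∀ r ∈ l, ‖(iot r : Ed d)‖ < h

lemma OK_append {d : ℕ} {h : ℝ} {l l' : List (Fin d → ℚ)} (hl : OK h l) (hl' : OK h l') :
    OK h (l ++ l') := by
  intro r hr
  rcases List.mem_append.1 hr with h1 | h1
  · exact hl r h1
  · exact hl' r h1

lemma len_nonneg {d : ℕ} (l : List (Fin d → ℚ)) : 0 ≤ len l := by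
  induction l with
  | nil => simp [len]
  | cons r l ih => simp only [len]; positivity

lemma norm_sum_le_len {d : ℕ} (l : List (Fin d → ℚ)) : ‖(iot l.sum : Ed d)‖ ≤ len l := by
  induction l with
  | nil => simp [len, iot_zero]
  | cons r l ih =>
    rw [List.sum_cons, iot_add, len]
    exact (norm_add_le _ _).trans (by linarith)

lemma cost_append {d : ℕ} (b : Ed d → Ed d → ℝ) (z : Ed d) (l l' : List (Fin d → ℚ)) :
    cost b z (l ++ l') = cost b z l + cost b (z + iot l.sum) l' := by
  induction l generalizing z with
  | nil => simp [cost, iot_zero]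
  | cons r l ih =>
    simp only [List.cons_append, cost, ih, List.sum_cons, iot_add]
    rw [add_assoc z]
    ring

lemma cost_le_len {d : ℕ} {b : Ed d → Ed d → ℝ} {C1 : ℝ} (hb : ∀ z q, b z q ≤ C1 * ‖q‖) (z : Ed d)
    (l : List (Fin d → ℚ)) : cost b z l ≤ C1 * len l := by
  induction l generalizing z with
  | nil => simp [cost, len]
  | cons r l ih =>
    simp only [cost, len]
    have := hb z (iot r)
    have := ih (z + iot r)
    linarith

lemma cost_cont {d : ℕ} {b : Ed d → Ed d → ℝ} (hb : ∀ q, Continuous fun z => b z q)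
    (l : List (Fin d → ℚ)) : Continuous fun z => cost b z l := by
  induction l with
  | nil => simp only [cost]; exact continuous_const
  | cons r l ih =>
    simp only [cost]
    exact (hb _).add (ih.comp (continuous_id.add continuous_const))

lemma cost_meas {d : ℕ} {Ω : Type*} [MeasurableSpace Ω] {b : Ed d → Ed d → Ω → ℝ}
    (hb : ∀ z q, Measurable fun ω => b z q ω) (z : Ed d) (l : List (Fin d → ℚ)) :
    Measurable fun ω => cost (fun z q => b z q ω) z l := by
  induction l generalizing z with
  | nil => simp only [cost]; exact measurable_const
  | cons r l ih =>
    simp only [cost]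
    exact (hb _ _).add (ih _)

lemma cost_stat {d : ℕ} {Ω : Type*} {b : Ed d → Ed d → Ω → ℝ} {τ : Ed d → Ω → Ω}
    (hb : ∀ z q y ω, b z q (τ y ω) = b (z + y) q ω) (z y : Ed d) (ω : Ω) (l : List (Fin d → ℚ)) :
    cost (fun z q => b z q (τ y ω)) z l = cost (fun z q => b z q ω) (z + y) l := by
  induction l generalizing z with
  | nil => simp only [cost]
  | cons r l ih =>
    have h1 := ih (z + iot r)
    rw [add_right_comm] at h1
    simp only [cost]
    rw [h1, hb]

lemma exists_straight {d : ℕ} {h : ℝ} (hh : 0 < h) (g : Fin d → ℚ) :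
    ∃ l : List (Fin d → ℚ), OK h l ∧ l.sum = g ∧ len l = ‖(iot g : Ed d)‖ := by
  obtain ⟨k, hk⟩ := exists_nat_gt (‖(iot g : Ed d)‖ / h)
  have hk0 : 0 < (k : ℝ) := lt_of_le_of_lt (by positivity) hk
  have hk0' : (k : ℚ) ≠ 0 := by
    have : (k : ℝ) ≠ 0 := hk0.ne'
    exact_mod_cast this
  have hr : (iot ((k : ℚ)⁻¹ • g) : Ed d) = (k : ℝ)⁻¹ • iot g := by rw [iot_smul]; push_cast; rfl
  have hrn : ‖(iot ((k : ℚ)⁻¹ • g) : Ed d)‖ = (k : ℝ)⁻¹ * ‖(iot g : Ed d)‖ := by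
    rw [hr, norm_smul, norm_inv, Real.norm_of_nonneg hk0.le]
  refine ⟨List.replicate k ((k : ℚ)⁻¹ • g), ?_, ?_, ?_⟩
  · intro r hr'
    rw [List.eq_of_mem_replicate hr', hrn]
    rw [div_lt_iff₀ hh] at hk
    rw [inv_mul_lt_iff₀ hk0]
    exact hk
  · rw [List.sum_replicate, ← Nat.cast_smul_eq_nsmul ℚ, smul_smul, mul_inv_cancel₀ hk0', one_smul]
  · have : ∀ n : ℕ, ∀ r : Fin d → ℚ, len (List.replicate n r) = n * ‖(iot r : Ed d)‖ := by
      intro n r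
      induction n with
      | zero => simp [len]
      | succ n ih =>
        simp only [List.replicate_succ, len, ih]
        push_cast; ring
    rw [this, hrn, mul_inv_cancel_left₀ hk0.ne']

lemma chain_inc {d : ℕ} {b : Ed d → Ed d → ℝ} {v : Ed d → ℝ} {h r : ℝ} {y0 : Ed d}
    (hinc : ∀ z q, ‖z - y0‖ ≤ r → ‖q‖ < h → v z ≤ v (z + q) + b z q)
    (l : List (Fin d → ℚ)) (hl : OK h l) (z : Ed d) (hz : ‖z - y0‖ + len l ≤ r) :
    v z ≤ v (z + iot l.sum) + cost b z l := by
  induction l generalizing z with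
  | nil => simp [cost, iot_zero]
  | cons s l ih =>
    simp only [len] at hz
    have h0 := len_nonneg l
    have h1 := hinc z (iot s) (by linarith [norm_nonneg (iot s : Ed d)]) (hl s (by simp))
    have h2 := ih (fun t ht => hl t (by simp [ht])) (z + iot s) (by
      have : z + iot s - y0 = (z - y0) + iot s := by abel
      rw [this]
      linarith [norm_add_le (z - y0) (iot s)])
    have e : z + iot (s :: l).sum = z + iot s + iot l.sum := by
      rw [List.sum_cons, iot_add, add_assoc]
    simp only [cost]
    rw [e]
    linarith

/-- Case A: construction of the corrector-like function. -/
lemma exists_w {d : ℕ} {b : Ed d → Ed d → ℝ} {h C1 κ C : ℝ} (hh : 0 < h) (hC1 : 0 ≤ C1)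
    (hb : ∀ z q, b z q ≤ C1 * ‖q‖) (hbc : Continuous fun x : Ed d × Ed d => b x.1 x.2)
    (hlow : ∀ l : List (Fin d → ℚ), OK h l → -C ≤ cost b 0 l + κ * ‖(iot l.sum : Ed d)‖) :
    ∃ w : Ed d → ℝ, Continuous w ∧ 0 ≤ w 0 ∧ (∀ y, w y ≤ κ * ‖y‖ + C) ∧
      ∀ z q, ‖q‖ < h → w z ≤ w (z + q) + b z q := by
  set U : (Fin d → ℚ) → ℝ := fun g => ⨅ l : {l : List (Fin d → ℚ) // OK h l ∧ l.sum = g},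
    cost b 0 l.1 with hU
  have hne : ∀ g, Nonempty {l : List (Fin d → ℚ) // OK h l ∧ l.sum = g} := by
    intro g
    obtain ⟨l, h1, h2, _⟩ := exists_straight hh g
    exact ⟨⟨l, h1, h2⟩⟩
  have hlow' : ∀ g, ∀ l : {l : List (Fin d → ℚ) // OK h l ∧ l.sum = g},
      -C - κ * ‖(iot g : Ed d)‖ ≤ cost b 0 l.1 := by
    intro g l
    have := hlow l.1 l.2.1
    rw [l.2.2] at this
    linarith
  have hbdd : ∀ g, BddBelow (Set.range fun l : {l : List (Fin d → ℚ) // OK h l ∧ l.sum = g} =>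
      cost b 0 l.1) := by
    intro g
    refine ⟨-C - κ * ‖(iot g : Ed d)‖, ?_⟩
    rintro _ ⟨l, rfl⟩
    exact hlow' g l
  have hUlow : ∀ g, -C - κ * ‖(iot g : Ed d)‖ ≤ U g := fun g => le_ciInf (hlow' g)
  have hUle : ∀ l, OK h l → U l.sum ≤ cost b 0 l := fun l hl =>
    ciInf_le (hbdd _) (⟨l, hl, rfl⟩ : {l' : List (Fin d → ℚ) // OK h l' ∧ l'.sum = l.sum})
  have hU0 : U 0 ≤ 0 := by
    have := hUle [] (by intro r hr; simp at hr)
    simpa [cost] using this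
  have hUext : ∀ g l', OK h l' → U (g + l'.sum) ≤ U g + cost b (iot g) l' := by
    intro g l' hl'
    rw [← sub_le_iff_le_add]
    apply le_ciInf
    rintro ⟨l, hl, rfl⟩
    have h1 := hUle (l ++ l') (OK_append hl hl')
    rw [cost_append, List.sum_append, zero_add] at h1
    simp only
    linarith
  have hUlip : ∀ g g', U g' ≤ U g + C1 * ‖(iot g' : Ed d) - iot g‖ := by
    intro g g'
    obtain ⟨l, h1, h2, h3⟩ := exists_straight hh (g' - g)
    have h4 := hUext g l h1
    have h5 := cost_le_len hb (iot g) l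
    rw [h2, add_sub_cancel] at h4
    rw [h3, iot_sub] at h5
    linarith
  set f : Ed d → ℝ := fun y => - U (Function.invFun iot y) with hf
  have hfi : ∀ g, f (iot g) = - U g := by
    intro g
    simp only [hf]
    rw [Function.leftInverse_invFun iot_injective g]
  have hflip : LipschitzOnWith (Real.toNNReal C1) f (Set.range iot) := by
    apply LipschitzOnWith.of_le_add_mul
    rintro _ ⟨g, rfl⟩ _ ⟨g', rfl⟩
    rw [hfi, hfi, Real.coe_toNNReal _ hC1, dist_eq_norm]
    have := hUlip g g'
    rw [norm_sub_rev] at this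
    linarith
  obtain ⟨w, hwL, hwf⟩ := hflip.extend_real
  have hwi : ∀ g, w (iot g) = - U g := by
    intro g
    rw [← hfi]
    exact (hwf ⟨g, rfl⟩).symm
  have hwc : Continuous w := hwL.continuous
  refine ⟨w, hwc, ?_, ?_, ?_⟩
  · rw [← iot_zero, hwi]; linarith
  · intro y
    by_contra hcon
    push Not at hcon
    have ho : IsOpen {y : Ed d | κ * ‖y‖ + C < w y} := isOpen_lt (by fun_prop) hwc
    obtain ⟨g, hg⟩ := iot_dense.exists_mem_open ho ⟨y, hcon⟩
    have hg' : κ * ‖(iot g : Ed d)‖ + C < w (iot g) := hg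
    rw [hwi] at hg'
    linarith [hUlow g]
  · intro z q hq
    by_contra hcon
    push Not at hcon
    have ho : IsOpen {x : Ed d × Ed d | ‖x.2‖ < h ∧ w (x.1 + x.2) + b x.1 x.2 < w x.1} := by
      apply IsOpen.and
      · exact isOpen_lt (by fun_prop) continuous_const
      · exact isOpen_lt (by fun_prop) (by fun_prop)
    have hD : DenseRange (Prod.map (iot (d := d)) (iot (d := d))) := iot_dense.prodMap iot_dense
    obtain ⟨⟨g, r⟩, hg1, hg2⟩ := hD.exists_mem_open ho ⟨(z, q), hq, hcon⟩
    simp only [Prod.map] at hg1 hg2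
    rw [← iot_add, hwi, hwi] at hg2
    have := hUext g [r] (by intro s hs; simp at hs; rw [hs]; exact hg1)
    simp only [List.sum_cons, List.sum_nil, add_zero, cost] at this
    linarith

/-! ### Probabilistic part for chains -/

/-- Assumptions on the cost of one step. -/
structure CostData {d : ℕ} {Ω : Type*} [MeasurableSpace Ω] (τ : Ed d → Ω → Ω)
    (b : Ed d → Ed d → Ω → ℝ) (h C1 : ℝ) : Prop where
  hh : 0 < h
  hC1 : 0 < C1
  hb : ∀ z q ω, b z q ω ≤ C1 * ‖q‖
  hbc : ∀ ω, Continuous fun x : Ed d × Ed d => b x.1 x.2 ω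
  hbm : ∀ z q, Measurable fun ω => b z q ω
  hbs : ∀ z q y ω, b z q (τ y ω) = b (z + y) q ω

/-- The cost of a chain from the origin. -/
def cst {d : ℕ} {Ω : Type*} (b : Ed d → Ed d → Ω → ℝ) (ω : Ω) (z : Ed d)
    (l : List (Fin d → ℚ)) : ℝ := cost (fun z q => b z q ω) z l

/-- Very negative chains in direction `e`. -/
def Ie {d : ℕ} {Ω : Type*} (b : Ed d → Ed d → Ω → ℝ) (h κ : ℝ) (e : Fin d → ℚ) : Set Ω :=
  {ω | ∀ m : ℕ, ∃ n : ℕ, 1 ≤ n ∧ ∃ l : List (Fin d → ℚ), OK h l ∧ l.sum = n • e ∧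
    cst b ω 0 l < -κ * n - m}

/-- Chains with cost below `-C`. -/
def XC {d : ℕ} {Ω : Type*} (b : Ed d → Ed d → Ω → ℝ) (h κ : ℝ) (C : ℕ) : Set Ω :=
  {ω | ∃ l : List (Fin d → ℚ), OK h l ∧ cst b ω 0 l + κ * ‖(iot l.sum : Ed d)‖ < -C}

/-- No good jump among the first `j` chains. -/
def Bad {d : ℕ} {Ω : Type*} (b : Ed d → Ed d → Ω → ℝ) (h κ : ℝ) (e : Fin d → ℚ) (j : ℕ) : Set Ω :=
  {ω | ¬ ∃ l : List (Fin d → ℚ), Encodable.encode l < j ∧ ∃ n : ℕ, 1 ≤ n ∧ n < j ∧ OK h l ∧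
    l.sum = n • e ∧ cst b ω 0 l < -κ * n}

section chains
variable {d : ℕ} {Ω : Type*} [MeasurableSpace Ω] {τ : Ed d → Ω → Ω} {b : Ed d → Ed d → Ω → ℝ}
  {h C1 : ℝ}

lemma cst_meas (D : CostData τ b h C1) (z : Ed d) (l : List (Fin d → ℚ)) :
    Measurable fun ω => cst b ω z l := cost_meas D.hbm z l

lemma cst_stat (D : CostData τ b h C1) (z y : Ed d) (ω : Ω) (l : List (Fin d → ℚ)) :
    cst b (τ y ω) z l = cst b ω (z + y) l := cost_stat D.hbs z y ω l

lemma cst_append (ω : Ω) (z : Ed d) (l l' : List (Fin d → ℚ)) :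
    cst b ω z (l ++ l') = cst b ω z l + cst b ω (z + iot l.sum) l' := cost_append _ z l l'

lemma cst_le_len (D : CostData τ b h C1) (ω : Ω) (z : Ed d) (l : List (Fin d → ℚ)) :
    cst b ω z l ≤ C1 * len l := cost_le_len (fun z q => D.hb z q ω) z l

lemma cst_cont (D : CostData τ b h C1) (ω : Ω) (l : List (Fin d → ℚ)) :
    Continuous fun z => cst b ω z l :=
  cost_cont (fun q => (D.hbc ω).comp (by fun_prop : Continuous fun z : Ed d => (z, q))) l

lemma Ie_meas (D : CostData τ b h C1) (κ : ℝ) (e : Fin d → ℚ) : MeasurableSet (Ie b h κ e) := by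
  unfold Ie
  rw [measurableSet_setOf]
  refine Measurable.forall fun m => Measurable.exists fun n => measurable_const.and
    (Measurable.exists fun l => measurable_const.and (measurable_const.and ?_))
  rw [← measurableSet_setOf]
  exact measurableSet_lt (cst_meas D 0 l) measurable_const

lemma XC_meas (D : CostData τ b h C1) (κ : ℝ) (C : ℕ) : MeasurableSet (XC b h κ C) := by
  unfold XC
  rw [measurableSet_setOf]
  refine Measurable.exists fun l => measurable_const.and ?_
  rw [← measurableSet_setOf]
  exact measurableSet_lt ((cst_meas D 0 l).add_const _) measurable_const

lemma Bad_meas (D : CostData τ b h C1) (κ : ℝ) (e : Fin d → ℚ) (j : ℕ) :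
    MeasurableSet (Bad b h κ e j) := by
  unfold Bad
  rw [measurableSet_setOf]
  refine Measurable.not (Measurable.exists fun l => measurable_const.and
    (Measurable.exists fun n => measurable_const.and (measurable_const.and
      (measurable_const.and (measurable_const.and ?_)))))
  rw [← measurableSet_setOf]
  exact measurableSet_lt (cst_meas D 0 l) measurable_const

lemma Ie_sub (D : CostData τ b h C1) (κ : ℝ) (e : Fin d → ℚ) (z : Ed d) {ω : Ω}
    (hω : ω ∈ Ie b h κ e) : τ z ω ∈ Ie b h κ e := by
  intro m
  obtain ⟨m', hm'⟩ := exists_nat_gt (m + 2 * (C1 * (‖z‖ + 1)))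
  obtain ⟨n, hn, l, hl, hls, hlc⟩ := hω m'
  refine ⟨n, hn, ?_⟩
  have ho : IsOpen {y : Ed d | ‖y‖ < 1 ∧ cst b ω y l < -κ * n - m'} :=
    (isOpen_lt (by fun_prop) continuous_const).and
      (isOpen_lt (cst_cont D ω l) continuous_const)
  have ho' : IsOpen {g : Ed d | ‖z + g‖ < 1 ∧ cst b ω (z + g) l < -κ * n - m'} :=
    ho.preimage (by fun_prop : Continuous fun g : Ed d => z + g)
  obtain ⟨g, hg1, hg2⟩ := iot_dense.exists_mem_open ho' ⟨-z, by simpa using hlc⟩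
  obtain ⟨l1, h1, h2, h3⟩ := exists_straight D.hh g
  obtain ⟨l2, h4, h5, h6⟩ := exists_straight D.hh (-g)
  refine ⟨l1 ++ (l ++ l2), OK_append h1 (OK_append hl h4), ?_, ?_⟩
  · simp only [List.sum_append, h2, h5, hls]; abel
  · rw [cst_stat D, zero_add, cst_append, cst_append, h2]
    have hg : ‖(iot g : Ed d)‖ ≤ ‖z‖ + 1 := by
      have : (iot g : Ed d) = (z + iot g) - z := by abel
      rw [this]
      linarith [norm_sub_le (z + iot g) z]
    have a1 := cst_le_len D ω z l1
    have a2 := cst_le_len D ω (z + iot g + iot l.sum) l2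
    rw [iot_neg, norm_neg] at h6
    rw [h3] at a1
    rw [h6] at a2
    have : C1 * ‖(iot g : Ed d)‖ ≤ C1 * (‖z‖ + 1) := by
      have := D.hC1
      gcongr
    linarith

lemma Ie_zero_one (D : CostData τ b h C1) {P : Measure Ω}
    (hτgrp : ∀ x y : Ed d, τ (x + y) = τ x ∘ τ y) (hτzero : τ 0 = id)
    (hτerg : ∀ A : Set Ω, MeasurableSet A → (∀ z : Ed d, τ z ⁻¹' A = A) → P A = 0 ∨ P A = 1)
    (κ : ℝ) (e : Fin d → ℚ) : P (Ie b h κ e) = 0 ∨ P (Ie b h κ e) = 1 := by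
  refine hτerg _ (Ie_meas D κ e) fun z => ?_
  ext ω
  constructor
  · intro hω
    have := Ie_sub D κ e (-z) hω
    have e1 : τ (-z) (τ z ω) = ω := by
      rw [← Function.comp_apply (f := τ (-z)), ← hτgrp, neg_add_cancel, hτzero, id]
    rwa [e1] at this
  · intro hω
    exact Ie_sub D κ e z hω

lemma tendsto_measureReal_zero {P : Measure Ω} [IsProbabilityMeasure P] {X : ℕ → Set Ω}
    (hm : ∀ j, MeasurableSet (X j)) (hanti : Antitone X) (h0 : P (⋂ j, X j) = 0) :
    Tendsto (fun j => P.real (X j)) atTop (𝓝 0) := by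
  have := tendsto_measure_iInter_atTop (μ := P) (fun j => (hm j).nullMeasurableSet) hanti
    ⟨0, measure_ne_top _ _⟩
  rw [h0] at this
  simpa [Measure.real, Function.comp_def] using (ENNReal.tendsto_toReal ENNReal.zero_ne_top).comp this

lemma exists_net (d : ℕ) {θ : ℝ} (hθ : 0 < θ) : ∃ S : Finset (Fin d → ℚ), ∀ x : Ed d, ‖x‖ ≤ 1 →
    ∃ e ∈ S, ‖x - iot e‖ < θ := by
  obtain ⟨t, ht⟩ := (isCompact_closedBall (0 : Ed d) 1).elim_finite_subcover
    (fun e : Fin d → ℚ => Metric.ball (iot e) θ) (fun _ => Metric.isOpen_ball) (by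
      intro x _
      obtain ⟨e, he⟩ := iot_dense.exists_dist_lt x hθ
      exact Set.mem_iUnion.2 ⟨e, he⟩)
  refine ⟨t, fun x hx => ?_⟩
  have := ht (mem_closedBall_zero_iff.2 hx)
  simp only [Set.mem_iUnion, exists_prop] at this
  obtain ⟨e, he, hxe⟩ := this
  exact ⟨e, he, by simpa [dist_eq_norm] using hxe⟩

lemma iInter_XC_subset (D : CostData τ b h C1) {κ : ℝ} (hκ : 0 < κ) :
    ∃ S : Finset (Fin d → ℚ), ⋂ C, XC b h κ C ⊆ ⋃ e ∈ S, Ie b h (κ / 2) e := by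
  have hC1 := D.hC1
  obtain ⟨S, hS⟩ := exists_net d (θ := κ / (2 * C1)) (by positivity)
  refine ⟨S, fun ω hω => ?_⟩
  by_contra hcon
  simp only [Set.mem_iUnion, not_exists] at hcon
  have h1 : ∀ e ∈ S, ∃ m : ℕ, ∀ n : ℕ, 1 ≤ n → ∀ l : List (Fin d → ℚ), OK h l → l.sum = n • e →
      -(κ / 2) * n - m ≤ cst b ω 0 l := by
    intro e he
    have h2 := hcon e he
    simp only [Ie] at h2
    by_contra h3
    push Not at h3
    exact h2 (fun m => by
      obtain ⟨n, hn, l, hl, hls, hlc⟩ := h3 m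
      exact ⟨n, hn, l, hl, hls, hlc⟩)
  choose! m hm using h1
  obtain ⟨k, hk⟩ := exists_nat_gt (((∑ e ∈ S, m e : ℕ) : ℝ) + κ)
  obtain ⟨l, hl, hlc⟩ := Set.mem_iInter.1 hω k
  set g := l.sum with hg
  set n : ℕ := ⌊‖(iot g : Ed d)‖⌋₊ + 1 with hn
  have hn1 : ‖(iot g : Ed d)‖ < n := by rw [hn]; push_cast; exact Nat.lt_floor_add_one _
  have hn2 : (n : ℝ) ≤ ‖(iot g : Ed d)‖ + 1 := by
    rw [hn]; push_cast; linarith [Nat.floor_le (norm_nonneg (iot g : Ed d))]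
  have hn0 : (0 : ℝ) < n := lt_of_le_of_lt (norm_nonneg _) hn1
  obtain ⟨e, he, hxe⟩ := hS ((n : ℝ)⁻¹ • iot g) (by
    rw [norm_smul, norm_inv, Real.norm_of_nonneg hn0.le, inv_mul_le_iff₀ hn0]; linarith)
  have hdist : ‖(iot (n • e - g) : Ed d)‖ ≤ n * (κ / (2 * C1)) := by
    have : (iot (n • e - g) : Ed d) = -((n : ℝ) • ((n : ℝ)⁻¹ • iot g - iot e)) := by
      rw [iot_sub, iot_nsmul, smul_sub, smul_smul, mul_inv_cancel₀ hn0.ne', one_smul, neg_sub]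
    rw [this, norm_neg, norm_smul, Real.norm_of_nonneg hn0.le]
    gcongr
  obtain ⟨l', h1, h2, h3⟩ := exists_straight D.hh (n • e - g)
  have h4 := hm e he n (by omega) (l ++ l') (OK_append hl h1) (by
    rw [List.sum_append, h2, ← hg]; abel)
  rw [cst_append] at h4
  have h5 := cst_le_len D ω (0 + iot l.sum) l'
  rw [h3] at h5
  have h6 : C1 * ‖(iot (n • e - g) : Ed d)‖ ≤ κ / 2 * n := by
    calc C1 * ‖(iot (n • e - g) : Ed d)‖ ≤ C1 * (n * (κ / (2 * C1))) := by gcongr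
      _ = κ / 2 * n := by field_simp
  have h7 : (m e : ℝ) ≤ ((∑ e ∈ S, m e : ℕ) : ℝ) := by
    exact_mod_cast Finset.single_le_sum (f := m) (fun _ _ => Nat.zero_le _) he
  have h8 : κ * n ≤ κ * ‖(iot g : Ed d)‖ + κ := by nlinarith
  linarith

lemma XC_tendsto (D : CostData τ b h C1) {P : Measure Ω} [IsProbabilityMeasure P] {κ : ℝ}
    (hκ : 0 < κ) (hA : ∀ e, P (Ie b h (κ / 2) e) = 0) :
    Tendsto (fun C => P.real (XC b h κ C)) atTop (𝓝 0) := by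
  apply tendsto_measureReal_zero (fun C => XC_meas D κ C)
  · intro C C' hCC ω hω
    obtain ⟨l, hl, hlc⟩ := hω
    refine ⟨l, hl, ?_⟩
    have : (C : ℝ) ≤ C' := by exact_mod_cast hCC
    linarith
  · obtain ⟨S, hS⟩ := iInter_XC_subset D hκ
    refine measure_mono_null hS ?_
    exact (measure_biUnion_null_iff S.countable_toSet).2 (fun e _ => hA e)

lemma Bad_tendsto (D : CostData τ b h C1) {P : Measure Ω} [IsProbabilityMeasure P] {κ : ℝ}
    {e : Fin d → ℚ} (hB : P (Ie b h κ e) = 1) :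
    Tendsto (fun j => P.real (Bad b h κ e j)) atTop (𝓝 0) := by
  apply tendsto_measureReal_zero (fun C => Bad_meas D κ e C)
  · intro j j' hjj ω hω hcon
    apply hω
    obtain ⟨l, h1, n, h2, h3, h4⟩ := hcon
    exact ⟨l, h1.trans_le hjj, n, h2, h3.trans_le hjj, h4⟩
  · have h1 : P (Ie b h κ e)ᶜ = 0 := (prob_compl_eq_zero_iff (Ie_meas D κ e)).2 hB
    refine measure_mono_null ?_ h1
    intro ω hω hωI
    obtain ⟨n, hn, l, hl, hls, hlc⟩ := hωI 0
    have := Set.mem_iInter.1 hω (max (Encodable.encode l) n + 1)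
    apply this
    refine ⟨l, ?_, n, hn, ?_, hl, hls, by simpa using hlc⟩
    · exact Nat.lt_succ_of_le (le_max_left _ _)
    · exact Nat.lt_succ_of_le (le_max_right _ _)

lemma exists_len_bound (d : ℕ) (j : ℕ) : ∃ L : ℝ, 0 ≤ L ∧ ∀ l : List (Fin d → ℚ),
    Encodable.encode l < j → len l ≤ L := by
  have hfin : {l : List (Fin d → ℚ) | Encodable.encode l < j}.Finite :=
    (Set.finite_lt_nat j).preimage (Encodable.encode_injective.injOn)
  obtain ⟨L, hL⟩ := (hfin.image len).bddAbove
  refine ⟨max L 0, le_max_right _ _, fun l hl => le_max_of_le_left (hL ⟨l, hl, rfl⟩)⟩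

/-- Case B: greedy path. -/
lemma greedy_path (D : CostData τ b h C1) (hτgrp : ∀ x y : Ed d, τ (x + y) = τ x ∘ τ y)
    (hτzero : τ 0 = id) {κ : ℝ} (hκ : 0 < κ) {e : Fin d → ℚ} {j : ℕ}
    {L : ℝ} (hL0 : 0 ≤ L) (hL : ∀ l : List (Fin d → ℚ), Encodable.encode l < j → len l ≤ L)
    {ω : Ω} {v : Ed d → ℝ} {r : ℝ} {y0 z0 : Ed d}
    (hinc : ∀ z q, ‖z - y0‖ ≤ r → ‖q‖ < h → v z ≤ v (z + q) + b z q ω) (M : ℕ)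
    (hM : ‖z0 - y0‖ + M * ‖(iot e : Ed d)‖ + (L + ‖(iot e : Ed d)‖) ≤ r) :
    ∃ n : ℕ, M ≤ n ∧ n ≤ M + j ∧ v z0 + κ * n - (κ + C1 * ‖(iot e : Ed d)‖) *
      ∑ i ∈ Finset.range n, (Bad b h κ e j).indicator (fun _ => (1 : ℝ)) ((τ (iot e))^[i] (τ z0 ω))
      ≤ v (z0 + (n : ℝ) • iot e) := by
  have hC1 := D.hC1
  set f : ℕ → ℝ := fun i =>
    (Bad b h κ e j).indicator (fun _ => (1 : ℝ)) ((τ (iot e))^[i] (τ z0 ω)) with hf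
  have hf0 : ∀ i, 0 ≤ f i := fun i => Set.indicator_nonneg (fun _ _ => zero_le_one) _
  change ∃ n : ℕ, M ≤ n ∧ n ≤ M + j ∧ v z0 + κ * n - (κ + C1 * ‖(iot e : Ed d)‖) *
      ∑ i ∈ Finset.range n, f i ≤ v (z0 + (n : ℝ) • iot e)
  induction M with
  | zero => exact ⟨0, le_rfl, by omega, by simp⟩
  | succ M ih =>
    push_cast at hM
    have hen := norm_nonneg (iot e : Ed d)
    obtain ⟨n, hn1, hn2, hn3⟩ := ih (by nlinarith)
    by_cases hnM : M + 1 ≤ n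
    · exact ⟨n, hnM, by omega, hn3⟩
    have hnM' : n = M := by omega
    subst hnM'
    set z := z0 + (n : ℝ) • (iot e : Ed d) with hz
    have hzy : ‖z - y0‖ ≤ ‖z0 - y0‖ + n * ‖(iot e : Ed d)‖ := by
      have : z - y0 = (z0 - y0) + (n : ℝ) • iot e := by rw [hz]; abel
      rw [this]
      refine (norm_add_le _ _).trans ?_
      rw [norm_smul, Real.norm_of_nonneg (Nat.cast_nonneg n)]
    have hτz : (τ (iot e))^[n] (τ z0 ω) = τ z ω := by
      rw [iterate_tau hτgrp hτzero, ← Function.comp_apply (f := τ _), ← hτgrp, add_comm]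
    have hshift : ∀ m : ℕ, z + iot (m • e) = z0 + ((n + m : ℕ) : ℝ) • iot e := by
      intro m
      rw [hz, iot_nsmul]; push_cast
      rw [add_smul, add_assoc]
    by_cases hbad : τ z ω ∈ Bad b h κ e j
    · obtain ⟨l, h1, h2, h3⟩ := exists_straight D.hh e
      refine ⟨n + 1, le_rfl, by omega, ?_⟩
      have h4 := chain_inc (b := fun z q => b z q ω) hinc l h1 z (by rw [h3]; linarith)
      have h5 := cst_le_len D ω z l
      have h6 : f n = 1 := by
        simp only [hf]
        rw [hτz, Set.indicator_of_mem hbad]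
      have h7 := hshift 1
      rw [one_smul] at h7
      rw [h2, h7] at h4
      rw [h3] at h5
      unfold cst at h5
      rw [Finset.sum_range_succ, h6]
      push_cast at *
      linarith
    · simp only [Bad, Set.mem_setOf_eq, not_not] at hbad
      obtain ⟨l, hlj, m, hm1, hmj, hl, hls, hlc⟩ := hbad
      rw [cst_stat D, zero_add] at hlc
      unfold cst at hlc
      refine ⟨n + m, by omega, by omega, ?_⟩
      have h4 := chain_inc (b := fun z q => b z q ω) hinc l hl z (by
        have := hL l hlj
        linarith)
      rw [hls, hshift m] at h4
      have h8 : ∑ i ∈ Finset.range n, f i ≤ ∑ i ∈ Finset.range (n + m), f i :=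
        Finset.sum_le_sum_of_subset_of_nonneg (by
          intro x hx; simp only [Finset.mem_range] at *; omega) (fun i _ _ => hf0 i)
      have h9 : (κ + C1 * ‖(iot e : Ed d)‖) * ∑ i ∈ Finset.range n, f i ≤
          (κ + C1 * ‖(iot e : Ed d)‖) * ∑ i ∈ Finset.range (n + m), f i := by gcongr
      push_cast at *
      linarith

end chains

/-! ### The dichotomy -/

/-- Rescaled solutions. -/
structure VSol (d : ℕ) (F : Ed d → Ed d → ℝ) (ε : ℝ) (v : Ed d → ℝ) : Prop where
  sub : QSub d F ε v
  sup : QSuper d F ε v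
  cont : Continuous v
  bdd : ∃ M : ℝ, ∀ x, |v x| ≤ M

/-- Parameters. -/
structure Params {d : ℕ} {Ω : Type*} (H : Ed d → Ed d → Ω → ℝ) (μ Δ M0 : ℝ) (pk : ℕ → Ed d)
    (R N κ θ h : ℝ) : Prop where
  hM0 : ∀ p y ω, ‖p‖ ≤ 1 → |H p y ω| ≤ M0
  hR : 1 ≤ R
  hpk : DenseBall pk R
  hN : 0 < N
  hNη : 2 * R + 1 ≤ N * (Δ / 4)
  hΔ : 0 < Δ
  hκ0 : 0 < κ
  hκ : 3 * κ < 1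
  hcoer : ∀ p z ω, H p z ω ≤ μ + Δ / 4 → ‖p‖ ≤ R
  hcoer0 : ∀ p z ω, H p z ω ≤ M0 → ‖p‖ ≤ R
  hθ : 0 < θ
  hUC : ∀ ω p p' y y', ‖p‖ ≤ R + 1 → ‖p'‖ ≤ R + 1 → ‖p - p'‖ ≤ 3 * κ → ‖y - y'‖ ≤ θ →
      H p y ω ≤ H p' y' ω + Δ / 4
  hh : 0 < h
  hosc : ∀ ω p z z', ‖p‖ ≤ R → ‖z - z'‖ ≤ 2 * h → N * |H p z ω - H p z' ω| ≤ κ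
  hqc : ∀ ω p q y, H ((1/2 : ℝ) • (p + q)) y ω ≤ max (H p y ω) (H q y ω)
  hcont : ∀ ω, Continuous fun q : Ed d × Ed d => H q.1 q.2 ω

/-- The one-step cost. -/
def bb {d : ℕ} {Ω : Type*} (H : Ed d → Ed d → Ω → ℝ) (μ : ℝ) (pk : ℕ → Ed d) (N κ : ℝ)
    (z q : Ed d) (ω : Ω) : ℝ := ell pk N μ (fun p y => H p y ω) (-q) z + κ * ‖q‖

lemma exists_params {d : ℕ} {Ω : Type*} {H : Ed d → Ed d → Ω → ℝ}
    (hHcont : ∀ ω : Ω, Continuous fun q : Ed d × Ed d => H q.1 q.2 ω)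
    (hreg_uc : ∀ R : ℝ, 0 < R → ∀ ε : ℝ, 0 < ε → ∃ δ : ℝ, 0 < δ ∧ ∀ (ω : Ω) (p p' y y' : Ed d),
      ‖p‖ ≤ R → ‖p'‖ ≤ R → ‖p - p'‖ < δ → ‖y - y'‖ < δ → |H p y ω - H p' y' ω| < ε)
    (hcoer : ∀ M : ℝ, ∃ R : ℝ, ∀ (ω : Ω) (p y : Ed d), R ≤ ‖p‖ → M ≤ H p y ω)
    (hqc : ∀ (ω : Ω) (p q y : Ed d), H ((1/2 : ℝ) • (p + q)) y ω ≤ max (H p y ω) (H q y ω))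
    {M0 : ℝ} (hM0 : ∀ p y ω, ‖p‖ ≤ 1 → |H p y ω| ≤ M0) (μ : ℝ) {Δ : ℝ} (hΔ : 0 < Δ) :
    ∃ pk R N κ θ h, Params H μ Δ M0 pk R N κ θ h := by
  obtain ⟨R', hR'⟩ := hcoer (max (μ + Δ / 4) M0 + 1)
  set R := max R' 1 with hR
  have hR1 : 1 ≤ R := le_max_right _ _
  have hco : ∀ p z ω, H p z ω ≤ max (μ + Δ / 4) M0 → ‖p‖ ≤ R := by
    intro p z ω hp
    by_contra hcon
    push Not at hcon
    have := hR' ω p z ((le_max_left _ _).trans hcon.le)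
    linarith
  obtain ⟨pk, hpk⟩ := exists_denseBall d (R := R) (by linarith)
  obtain ⟨δ, hδ, hδ'⟩ := hreg_uc (R + 1) (by linarith) (Δ / 4) (by positivity)
  set κ := min (1 / 4) (δ / 4) with hκ
  have hκ0 : 0 < κ := by positivity
  have hκ1 : κ ≤ 1 / 4 := min_le_left _ _
  have hκ2 : κ ≤ δ / 4 := min_le_right _ _
  set N := (2 * R + 1) / (Δ / 4) with hN
  have hN0 : 0 < N := by positivity
  obtain ⟨δ2, hδ2, hδ2'⟩ := hreg_uc R (by linarith) (κ / N) (by positivity)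
  refine ⟨pk, R, N, κ, δ / 2, δ2 / 3, hM0, hR1, hpk, hN0, ?_, hΔ, hκ0, by linarith, ?_, ?_,
    by positivity, ?_, by positivity, ?_, hqc, hHcont⟩
  · rw [hN, div_mul_cancel₀ _ (by positivity)]
  · intro p z ω hp; exact hco p z ω (hp.trans (le_max_left _ _))
  · intro p z ω hp; exact hco p z ω (hp.trans (le_max_right _ _))
  · intro ω p p' y y' h1 h2 h3 h4
    have := hδ' ω p p' y y' h1 h2 (by linarith) (by linarith)
    linarith [le_abs_self (H p y ω - H p' y' ω)]
  · intro ω p z z' h1 h2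
    have := hδ2' ω p p z z' h1 h1 (by simpa using hδ2) (by linarith)
    rw [lt_div_iff₀ hN0] at this
    linarith

lemma exists_costData {d : ℕ} {Ω : Type*} [MeasurableSpace Ω] {τ : Ed d → Ω → Ω}
    {H : Ed d → Ed d → Ω → ℝ} {μ Δ M0 : ℝ} {pk : ℕ → Ed d} {R N κ θ h : ℝ}
    (hp : Params H μ Δ M0 pk R N κ θ h)
    (hHmeas : Measurable fun x : Ed d × Ed d × Ω => H x.1 x.2.1 x.2.2)
    (hHstat : ∀ (p y z : Ed d) (ω : Ω), H p y (τ z ω) = H p (y + z) ω)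
    (hreg_bdd : ∀ R : ℝ, 0 < R → ∃ M : ℝ, ∀ (ω : Ω) (p y : Ed d), ‖p‖ ≤ R → |H p y ω| ≤ M)
    (hreg_uc : ∀ R : ℝ, 0 < R → ∀ ε : ℝ, 0 < ε → ∃ δ : ℝ, 0 < δ ∧ ∀ (ω : Ω) (p p' y y' : Ed d),
      ‖p‖ ≤ R → ‖p'‖ ≤ R → ‖p - p'‖ < δ → ‖y - y'‖ < δ → |H p y ω - H p' y' ω| < ε) :
    ∃ C1, CostData τ (bb H μ pk N κ) h C1 := by
  have hR := hp.hR
  have hN := hp.hN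
  have hκ0 := hp.hκ0
  obtain ⟨M1, hM1⟩ := hreg_bdd R (by linarith)
  have hM : ∀ ω p z, ‖p‖ ≤ R → max (H p z ω - μ) 0 ≤ |M1| + |μ| := by
    intro ω p z hpR
    apply max_le
    · have := hM1 ω p z hpR
      linarith [le_abs_self (H p z ω), neg_abs_le μ, le_abs_self M1]
    · positivity
  have hlip : ∀ ω q q' z, ell pk N μ (fun p y => H p y ω) q z ≤
      ell pk N μ (fun p y => H p y ω) q' z + (R + N * (|M1| + |μ|)) * ‖q - q'‖ := fun ω q q' z =>
    ell_lip hp.hpk hN.le (hM ω) q q' z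
  have hC : 0 ≤ R + N * (|M1| + |μ|) := by positivity
  refine ⟨R + N * (|M1| + |μ|) + κ, hp.hh, by positivity, ?_, ?_, ?_, ?_⟩
  · intro z q ω
    have := hlip ω (-q) 0 z
    rw [ell_zero, sub_zero, norm_neg] at this
    unfold bb
    linarith
  · intro ω
    have hell : Continuous fun x : Ed d × Ed d => ell pk N μ (fun p y => H p y ω) x.1 x.2 := by
      apply continuous_prod_of_continuous_lipschitzWith _ (Real.toNNReal (R + N * (|M1| + |μ|)))
      · intro q
        rw [Metric.continuous_iff]
        intro z ε hε
        obtain ⟨δ, hδ, hδ'⟩ := hreg_uc R (by linarith) (ε / (2 * (‖q‖ + 1)) / N) (by positivity)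
        refine ⟨δ, hδ, fun z' hz' => ?_⟩
        have hq : ε / (2 * (‖q‖ + 1)) * ‖q‖ < ε := by
          rw [div_mul_eq_mul_div, div_lt_iff₀ (by positivity)]
          nlinarith [norm_nonneg q]
        have key : ∀ a a' : Ed d, ‖a - a'‖ < δ → ell pk N μ (fun p y => H p y ω) q a ≤
            ell pk N μ (fun p y => H p y ω) q a' + ε / (2 * (‖q‖ + 1)) * ‖q‖ := by
          intro a a' haa
          apply ell_osc hp.hpk hN.le
          intro p hpR
          have := hδ' ω p p a a' hpR hpR (by simpa using hδ) haa
          rw [lt_div_iff₀ hN] at this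
          linarith
        rw [dist_eq_norm] at hz'
        have k1 := key z' z hz'
        have k2 := key z z' (by rwa [norm_sub_rev])
        rw [Real.dist_eq, abs_lt]
        constructor <;> linarith
      · intro z
        apply LipschitzWith.of_le_add_mul
        intro q q'
        rw [Real.coe_toNNReal _ hC, dist_eq_norm]
        exact hlip ω q q' z
    unfold bb
    exact (hell.comp (by fun_prop : Continuous fun x : Ed d × Ed d => (-x.2, x.1))).add
      (by fun_prop)
  · intro z q
    unfold bb ell
    refine Measurable.add_const (Measurable.iSup fun k => ?_) _
    have : Measurable fun ω => H (pk k) z ω :=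
      hHmeas.comp (measurable_const.prodMk (measurable_const.prodMk measurable_id))
    exact measurable_const.sub (((this.sub_const μ).max measurable_const).const_mul _)
  · intro z q y ω
    simp only [bb, ell, hHstat]

section dich
variable {d : ℕ} {Ω : Type*} {H : Ed d → Ed d → Ω → ℝ} {μ Δ M0 : ℝ} {pk : ℕ → Ed d}
  {R N κ θ h : ℝ}

lemma vsol_abs (hp : Params H μ Δ M0 pk R N κ θ h) {ω : Ω} {ε : ℝ} (hε : 0 < ε) {v : Ed d → ℝ}
    (hv : VSol d (fun p y => H p y ω) ε v) (x : Ed d) : |ε * v x| ≤ M0 := by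
  obtain ⟨M, hM⟩ := hv.bdd
  rw [abs_le]
  exact ⟨qsuper_bound hε hv.sup hv.cont hM (fun p y => hp.hM0 p y ω) x,
    qsub_bound hε hv.sub hv.cont hM (fun p y => hp.hM0 p y ω) x⟩

lemma vsol_lip (hp : Params H μ Δ M0 pk R N κ θ h) {ω : Ω} {ε : ℝ} (hε : 0 < ε) {v : Ed d → ℝ}
    (hv : VSol d (fun p y => H p y ω) ε v) (x y : Ed d) : v x ≤ v y + R * ‖x - y‖ := by
  have := qsub_segment hv.sub hv.cont (y := y) (q := x - y) (r := ‖x - y‖ + 1)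
    (a := R * ‖x - y‖) (by linarith) (by
      intro z p _ hz
      have h1 := (abs_le.1 (vsol_abs hp hε hv z)).1
      have h2 : ‖p‖ ≤ R := hp.hcoer0 p z ω (by linarith)
      exact (real_inner_le_norm _ _).trans (by gcongr))
  simpa using this

lemma vsol_inc (hp : Params H μ Δ M0 pk R N κ θ h) {ω : Ω} {ε : ℝ} {v : Ed d → ℝ}
    (hv : VSol d (fun p y => H p y ω) ε v) {z q : Ed d} (hq : ‖q‖ < h)
    (hz : ∀ z', ‖z' - z‖ ≤ 2 * h → -μ ≤ ε * v z') :
    v z ≤ v (z + q) + bb H μ pk N κ z q ω := by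
  have hΔ := hp.hΔ
  have := qsub_segment hv.sub hv.cont (y := z + q) (q := -q) (r := h)
    (a := bb H μ pk N κ z q ω) (by simpa using hq) (by
      intro z' p hz' hle
      have hzz : ‖z' - z‖ ≤ 2 * h := by
        have e : z' - z = (z' - (z + q)) + q := by abel
        rw [e]
        linarith [norm_add_le (z' - (z + q)) q]
      have h1 := hz z' hzz
      have h2 : H p z' ω ≤ μ := by linarith
      have h3 : ‖p‖ ≤ R := hp.hcoer p z' ω (by linarith)
      have h4 := inner_le_ell (μ := μ) (F := fun p y => H p y ω) hp.hpk hp.hN.le (-q) z' p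
        ((hp.hcont ω).comp (by fun_prop : Continuous fun p : Ed d => (p, z'))) h3 h2
      have h5 := ell_osc (μ := μ) (F := fun p y => H p y ω) hp.hpk hp.hN.le (κ := κ) (-q) z' z
        (fun p hpR => hp.hosc ω p z' z hpR hzz)
      rw [norm_neg] at h5
      unfold bb
      linarith)
  simpa using this

lemma qsuper_shift {F : Ed d → Ed d → ℝ} {ε : ℝ} {v : Ed d → ℝ} (hv : QSuper d F ε v) (z : Ed d) :
    QSuper d (fun p y => F p (y + z)) ε (fun y => v (y + z)) := by
  intro α a x hx
  have h1 := hv α (a + z) (x + z) (by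
    have ht : Tendsto (fun y : Ed d => y - z) (𝓝 (x + z)) (𝓝 x) := by
      have : Continuous fun y : Ed d => y - z := by fun_prop
      simpa using this.tendsto (x + z)
    filter_upwards [ht.eventually hx] with y hy
    simp only [sub_add_cancel] at hy
    have e1 : x + z - (a + z) = x - a := by abel
    have e2 : y - (a + z) = y - z - a := by abel
    rw [e1, e2]
    exact hy)
  have e1 : x + z - (a + z) = x - a := by abel
  rw [e1] at h1
  exact h1

variable [MeasurableSpace Ω] {P : Measure Ω} [IsProbabilityMeasure P] {τ : Ed d → Ω → Ω} {C1 : ℝ}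

lemma caseA (hd : 0 < d) (hp : Params H μ Δ M0 pk R N κ θ h)
    (D : CostData τ (bb H μ pk N κ) h C1)
    (hτmp : ∀ y : Ed d, MeasurePreserving (τ y) P P)
    (hτgrp : ∀ x y : Ed d, τ (x + y) = τ x ∘ τ y) (hτzero : τ 0 = id)
    (hHstat : ∀ (p y z : Ed d) (ω : Ω), H p y (τ z ω) = H p (y + z) ω)
    (hA : ∀ e, P (Ie (bb H μ pk N κ) h (κ / 2) e) = 0) (K : ℕ) :
    ∀ᵐ ω ∂P, ∃ ε0 : ℝ, 0 < ε0 ∧ ∀ ε : ℝ, 0 < ε → ε < ε0 → ∀ v,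
      VSol d (fun p y => H p y ω) ε v → ∀ x : Ed d, ‖x‖ ≤ K / ε → -μ - Δ ≤ ε * v x := by
  have hΔ := hp.hΔ
  have hR := hp.hR
  have hR0 : 0 < R := by linarith
  filter_upwards [density' hτmp hτgrp hτzero (ρ := Δ / (4 * R)) (K := K + 1) (by positivity)
    (by positivity) (XC (bb H μ pk N κ) h κ) (XC_meas D κ) (XC_tendsto D hp.hκ0 hA)] with ω hω
  obtain ⟨C, R1, hR1, hω⟩ := hω
  refine ⟨min (1 / R1) (Δ / (4 * (C + 1))), by positivity, fun ε hε hε0 v hv x hx => ?_⟩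
  have hε1 : ε < 1 / R1 := hε0.trans_le (min_le_left _ _)
  have hε2 : ε < Δ / (4 * (C + 1)) := hε0.trans_le (min_le_right _ _)
  have hRε : R1 ≤ 1 / ε := by
    rw [lt_div_iff₀ hR1] at hε1
    rw [le_div_iff₀ hε]
    linarith
  obtain ⟨z0, hz0, hz0X⟩ := hω (1 / ε) hRε x (by
    refine hx.trans ?_
    rw [mul_one_div]
    gcongr
    linarith)
  have hlow : ∀ l : List (Fin d → ℚ), OK h l →
      -(C : ℝ) ≤ cost (fun z q => bb H μ pk N κ z q (τ z0 ω)) 0 l + κ * ‖(iot l.sum : Ed d)‖ := by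
    intro l hl
    by_contra hcon
    push Not at hcon
    exact hz0X ⟨l, hl, hcon⟩
  obtain ⟨w, hwc, hw0, hwC, hwi⟩ := exists_w hp.hh D.hC1.le (fun z q => D.hb z q (τ z0 ω))
    (D.hbc (τ z0 ω)) hlow
  obtain ⟨M, hM⟩ := hv.bdd
  have hF : (fun p y => H p y (τ z0 ω)) = fun p y => H p (y + z0) ω := by
    funext p y; rw [hHstat]
  have hcomp := comparison_at_zero (F := fun p y => H p y (τ z0 ω)) (μ := μ) hd hp.hpk hp.hN.le
    hp.hNη (by positivity) hp.hκ0 hp.hκ (by linarith)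
    (fun z => (hp.hcont (τ z0 ω)).comp (by fun_prop : Continuous fun p : Ed d => (p, z)))
    (fun p q z => hp.hqc (τ z0 ω) p q z) (fun p z => hp.hcoer p z (τ z0 ω)) hp.hθ
    (hp.hUC (τ z0 ω)) hε (v := fun y => v (y + z0))
    (by rw [hF]; exact qsuper_shift hv.sup z0) (hv.cont.comp (by fun_prop)) hR0.le
    (by
      intro x y
      have := vsol_lip hp hε hv (x + z0) (y + z0)
      rwa [add_sub_add_right_eq_sub] at this)
    (fun x => hM _) hwc hp.hh hwi hw0 hwC
  simp only [zero_add] at hcomp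
  have h1 := vsol_lip hp hε hv z0 x
  have h2 : ε * (R * ‖z0 - x‖) ≤ Δ / 4 := by
    calc ε * (R * ‖z0 - x‖) ≤ ε * (R * (Δ / (4 * R) * (1 / ε))) := by gcongr
      _ = Δ / 4 := by field_simp
  have h3 : ε * C ≤ Δ / 4 := by
    rw [lt_div_iff₀ (by positivity)] at hε2
    linarith
  have h4 : ε * v z0 ≤ ε * (v x + R * ‖z0 - x‖) := by gcongr
  linarith

set_option maxHeartbeats 1000000 in
lemma caseB (hp : Params H μ Δ M0 pk R N κ θ h)
    (D : CostData τ (bb H μ pk N κ) h C1)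
    (hτmp : ∀ y : Ed d, MeasurePreserving (τ y) P P)
    (hτgrp : ∀ x y : Ed d, τ (x + y) = τ x ∘ τ y) (hτzero : τ 0 = id)
    {e : Fin d → ℚ} (hB : P (Ie (bb H μ pk N κ) h (κ / 2) e) = 1) (K : ℕ) :
    ∀ᵐ ω ∂P, ∃ ε0 : ℝ, 0 < ε0 ∧ ∀ ε : ℝ, 0 < ε → ε < ε0 → ∀ v,
      VSol d (fun p y => H p y ω) ε v → ∀ x : Ed d, ‖x‖ ≤ K / ε → ε * v x ≤ -μ + Δ := by
  have hΔ := hp.hΔ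
  have hR := hp.hR
  have hR0 : 0 < R := by linarith
  have hκ0 := hp.hκ0
  have hC1 := D.hC1
  have hh := hp.hh
  set E := ‖(iot e : Ed d)‖ with hE
  have hE0 : 0 ≤ E := norm_nonneg _
  set κ2 := κ / 2 with hκ2
  have hκ20 : 0 < κ2 := by positivity
  set α := κ2 / (2 * (κ2 + C1 * E)) with hα
  have hα0 : 0 < α := by positivity
  set κ3 := κ2 / (8 * (E + 1)) with hκ3
  have hκ30 : 0 < κ3 := by positivity
  set Δr := Δ / (2 * R) with hΔr
  have hΔr0 : 0 < Δr := by positivity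
  set s := Δr / (4 * (E + 1)) with hs
  have hs0 : 0 < s := by positivity
  set ρ := min (Δr / 4) (κ2 * s / (8 * (R + κ3))) with hρ
  have hρ0 : 0 < ρ := by positivity
  set b := bb H μ pk N κ with hb
  have hXt : Tendsto (fun j => P.real (MaxSet (τ (iot e)) (Bad b h κ2 e j) α)) atTop (𝓝 0) := by
    have h1 := (Bad_tendsto D hB).div_const α
    rw [zero_div] at h1
    exact squeeze_zero (fun _ => measureReal_nonneg)
      (fun j => maximal_ineq (hτmp _) (Bad_meas D κ2 e j) hα0) h1
  filter_upwards [density' hτmp hτgrp hτzero (ρ := ρ) (K := K + 2 * |M0| / κ3 + 1) hρ0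
    (by positivity) _ (fun j => measurableSet_MaxSet (hτmp _).measurable (Bad_meas D κ2 e j) α)
    hXt] with ω hω
  obtain ⟨j, R1, hR1, hω⟩ := hω
  obtain ⟨L, hL0, hL⟩ := exists_len_bound d j
  refine ⟨min (1 / R1) (min (Δr / (2 * h)) (Δr / (2 * (2 * E + L + 1)))), by positivity,
    fun ε hε hε0 v hv x hx => ?_⟩
  have hε1 : ε < 1 / R1 := hε0.trans_le (min_le_left _ _)
  have hε2 : ε < Δr / (2 * h) := hε0.trans_le ((min_le_right _ _).trans (min_le_left _ _))
  have hε3 : ε < Δr / (2 * (2 * E + L + 1)) :=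
    hε0.trans_le ((min_le_right _ _).trans (min_le_right _ _))
  have hRε : R1 ≤ 1 / ε := by
    rw [lt_div_iff₀ hR1] at hε1
    rw [le_div_iff₀ hε]
    linarith
  have hhε : 2 * h ≤ Δr / ε := by
    rw [lt_div_iff₀ (by positivity)] at hε2
    rw [le_div_iff₀ hε]
    linarith
  have hLε : 2 * E + L ≤ Δr / ε / 2 := by
    rw [lt_div_iff₀ (by positivity)] at hε3
    rw [div_div, le_div_iff₀ (by positivity)]
    nlinarith
  by_contra hcon
  push Not at hcon
  have habs := vsol_abs hp hε hv
  have hM0 : 0 ≤ M0 := (abs_nonneg _).trans (habs 0)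
  have hlip := vsol_lip hp hε hv
  have hvb : ∀ y, |v y| ≤ M0 / ε := by
    intro y
    have := habs y
    rw [abs_mul, abs_of_pos hε] at this
    rw [le_div_iff₀ hε]
    linarith
  -- maximum point
  obtain ⟨y0, hy0⟩ : ∃ y, ∀ z, v z - κ3 * ‖z - x‖ ≤ v y - κ3 * ‖y - x‖ := by
    have hcv := hv.cont
    apply Continuous.exists_forall_ge' (by fun_prop) x
    have h1 : Tendsto (fun z : Ed d => ‖z - x‖) (cocompact (Ed d)) atTop := by
      have := tendsto_dist_left_cocompact_atTop x
      refine this.congr (fun z => ?_)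
      rw [dist_comm, dist_eq_norm]
    filter_upwards [h1.eventually_ge_atTop (2 * (M0 / ε) / κ3)] with z hz
    rw [div_le_iff₀ hκ30] at hz
    have h2 := (abs_le.1 (hvb z)).2
    have h3 := (abs_le.1 (hvb x)).1
    simp only [sub_self, norm_zero, mul_zero, sub_zero]
    linarith
  have hxy := hy0 x
  simp only [sub_self, norm_zero, mul_zero, sub_zero] at hxy
  have hyx : ‖y0 - x‖ ≤ 2 * M0 / κ3 / ε := by
    rw [div_div, mul_comm κ3 ε, ← div_div, le_div_iff₀ hκ30]
    have h2 := (abs_le.1 (hvb y0)).2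
    have h3 := (abs_le.1 (hvb x)).1
    have : 2 * M0 / ε = M0 / ε + M0 / ε := by ring
    linarith
  have hy0n : ‖y0‖ ≤ (K + 2 * |M0| / κ3 + 1) * (1 / ε) := by
    have e1 : y0 = (y0 - x) + x := by abel
    have h1 : ‖y0‖ ≤ ‖y0 - x‖ + ‖x‖ := by
      conv_lhs => rw [e1]
      exact norm_add_le _ _
    rw [abs_of_nonneg hM0]
    have e2 : (K + 2 * M0 / κ3 + 1) * (1 / ε) = K / ε + 2 * M0 / κ3 / ε + 1 / ε := by ring
    have : 0 < 1 / ε := by positivity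
    rw [e2]
    linarith
  obtain ⟨z0, hz0, hz0X⟩ := hω (1 / ε) hRε y0 hy0n
  rw [mul_one_div] at hz0
  have hvy : v x ≤ v y0 := by
    have : 0 ≤ κ3 * ‖y0 - x‖ := by positivity
    linarith
  have hgrow : ∀ y, v y ≤ v y0 + κ3 * ‖y - y0‖ := by
    intro y
    have h1 := hy0 y
    have e1 : y - x = (y - y0) + (y0 - x) := by abel
    have h2 : ‖y - x‖ ≤ ‖y - y0‖ + ‖y0 - x‖ := by
      rw [e1]
      exact norm_add_le _ _
    have h3 : κ3 * ‖y - x‖ ≤ κ3 * (‖y - y0‖ + ‖y0 - x‖) := by gcongr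
    linarith
  have hinc : ∀ z q, ‖z - y0‖ ≤ Δr / ε → ‖q‖ < h → v z ≤ v (z + q) + b z q ω := by
    intro z q hz hq
    apply vsol_inc hp hv hq
    intro z' hz'
    have h1 := hlip y0 z'
    have h2 : ‖y0 - z'‖ ≤ 2 * (Δr / ε) := by
      have e1 : y0 - z' = (y0 - z) + (z - z') := by abel
      have h3 : ‖y0 - z'‖ ≤ ‖y0 - z‖ + ‖z - z'‖ := by
        rw [e1]
        exact norm_add_le _ _
      rw [norm_sub_rev y0 z, norm_sub_rev z z'] at h3
      linarith
    have h3 : R * ‖y0 - z'‖ ≤ R * (2 * (Δr / ε)) := by gcongr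
    have h4 : ε * (R * (2 * (Δr / ε))) = Δ := by rw [hΔr]; field_simp
    have h5 : ε * v x ≤ ε * (v z' + R * (2 * (Δr / ε))) := by
      apply mul_le_mul_of_nonneg_left _ hε.le
      linarith
    rw [mul_add, h4] at h5
    linarith
  set M := ⌈s / ε⌉₊ with hM
  have hsε : 0 < s / ε := by positivity
  have hM1 : s / ε ≤ M := Nat.le_ceil _
  have hM2 : (M : ℝ) ≤ s / ε + 1 := (Nat.ceil_lt_add_one hsε.le).le
  have hsE : s * E ≤ Δr / 4 := by
    rw [hs, div_mul_eq_mul_div, div_le_div_iff₀ (by positivity) (by positivity)]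
    nlinarith
  have hMr : ‖z0 - y0‖ + M * E + (L + E) ≤ Δr / ε := by
    have h1 : M * E ≤ (s / ε + 1) * E := by gcongr
    have h2 : s / ε * E ≤ Δr / ε / 4 := by
      calc s / ε * E = s * E / ε := by ring
        _ ≤ Δr / 4 / ε := by gcongr
        _ = Δr / ε / 4 := by ring
    have h3 : ρ / ε ≤ Δr / ε / 4 := by
      calc ρ / ε ≤ Δr / 4 / ε := by gcongr; exact min_le_left _ _
        _ = Δr / ε / 4 := by ring
    linarith
  obtain ⟨n, hn1, hn2, hn3⟩ := greedy_path D hτgrp hτzero hκ20 hL0 hL hinc M hMr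
  have hnM : (M : ℝ) ≤ n := by exact_mod_cast hn1
  have hn0 : 1 ≤ n := by
    have : (0 : ℝ) < n := by linarith
    exact_mod_cast this
  have hnpos : (0 : ℝ) < n := by exact_mod_cast hn0
  have hcount : ∑ i ∈ Finset.range n,
      (Bad b h κ2 e j).indicator (fun _ => (1 : ℝ)) ((τ (iot e))^[i] (τ z0 ω)) ≤ α * n := by
    by_contra hc
    push Not at hc
    exact hz0X ⟨n, hn0, hc⟩
  have h1 : (κ2 + C1 * E) * ∑ i ∈ Finset.range n,
      (Bad b h κ2 e j).indicator (fun _ => (1 : ℝ)) ((τ (iot e))^[i] (τ z0 ω)) ≤ κ2 * n / 2 := by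
    calc _ ≤ (κ2 + C1 * E) * (α * n) := by gcongr
      _ = κ2 * n / 2 := by rw [hα]; field_simp
  have h2 := hgrow (z0 + (n : ℝ) • iot e)
  have h3 : ‖z0 + (n : ℝ) • iot e - y0‖ ≤ ‖z0 - y0‖ + n * E := by
    have e1 : z0 + (n : ℝ) • iot e - y0 = (z0 - y0) + (n : ℝ) • iot e := by abel
    rw [e1]
    refine (norm_add_le _ _).trans ?_
    rw [norm_smul, Real.norm_of_nonneg hnpos.le]
  have h4 : κ3 * ‖z0 + (n : ℝ) • iot e - y0‖ ≤ κ3 * (‖z0 - y0‖ + n * E) := by gcongr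
  have h5 := hlip y0 z0
  rw [norm_sub_rev] at h5
  have h6 : κ3 * E ≤ κ2 / 8 := by
    rw [hκ3, div_mul_eq_mul_div, div_le_div_iff₀ (by positivity) (by positivity)]
    nlinarith
  have h7 : κ3 * E * n ≤ κ2 / 8 * n := by gcongr
  have h8 : (R + κ3) * ‖z0 - y0‖ ≤ κ2 / 8 * n := by
    calc (R + κ3) * ‖z0 - y0‖ ≤ (R + κ3) * (κ2 * s / (8 * (R + κ3)) / ε) := by
          gcongr
          refine hz0.trans ?_
          gcongr
          exact min_le_right _ _
      _ = κ2 / 8 * (s / ε) := by field_simp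
      _ ≤ κ2 / 8 * n := by gcongr; linarith
  have h9 : 0 < κ2 * n := by positivity
  nlinarith

end dich

/-! ### The effective constant and the conclusion -/

/-- Almost sure eventual lower bound. -/
def AL {d : ℕ} {Ω : Type*} [MeasurableSpace Ω] (P : Measure Ω) (H : Ed d → Ed d → Ω → ℝ)
    (t : ℝ) : Prop :=
  ∀ K : ℕ, ∀ᵐ ω ∂P, ∃ ε0 : ℝ, 0 < ε0 ∧ ∀ ε : ℝ, 0 < ε → ε < ε0 → ∀ v,
      VSol d (fun p y => H p y ω) ε v → ∀ x : Ed d, ‖x‖ ≤ K / ε → -t ≤ ε * v x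

/-- Almost sure eventual upper bound. -/
def BU {d : ℕ} {Ω : Type*} [MeasurableSpace Ω] (P : Measure Ω) (H : Ed d → Ed d → Ω → ℝ)
    (t : ℝ) : Prop :=
  ∀ K : ℕ, ∀ᵐ ω ∂P, ∃ ε0 : ℝ, 0 < ε0 ∧ ∀ ε : ℝ, 0 < ε → ε < ε0 → ∀ v,
      VSol d (fun p y => H p y ω) ε v → ∀ x : Ed d, ‖x‖ ≤ K / ε → ε * v x ≤ -t

section concl
variable {d : ℕ} {Ω : Type*} [MeasurableSpace Ω] {P : Measure Ω} {H : Ed d → Ed d → Ω → ℝ}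

lemma AL.mono {s t : ℝ} (hs : AL P H s) (hst : s ≤ t) : AL P H t := by
  intro K
  filter_upwards [hs K] with ω hω
  obtain ⟨ε0, h0, h1⟩ := hω
  exact ⟨ε0, h0, fun ε hε hε' v hv x hx => by linarith [h1 ε hε hε' v hv x hx]⟩

lemma exists_level
    (hdich : ∀ a b : ℝ, a < b → AL P H b ∨ BU P H a) {M0 : ℝ} (hA : AL P H M0)
    (hB : ∀ a, a ≤ -M0 → BU P H a) (hM0 : 0 ≤ M0) :
    ∃ c : ℝ, (∀ b, c < b → AL P H b) ∧ ∀ a, a < c → BU P H a := by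
  set S := {t : ℝ | -M0 - 1 ≤ t ∧ AL P H t} with hS
  have hne : S.Nonempty := ⟨M0, by linarith, hA⟩
  have hbd : BddBelow S := ⟨-M0 - 1, fun t ht => ht.1⟩
  refine ⟨sInf S, fun b hb => ?_, fun a ha => ?_⟩
  · obtain ⟨t, ht, htb⟩ := exists_lt_of_csInf_lt hne hb
    exact ht.2.mono htb.le
  · rcases hdich a ((a + sInf S) / 2) (by linarith) with h1 | h1
    · by_cases h2 : -M0 - 1 ≤ (a + sInf S) / 2
      · have := csInf_le hbd (show (a + sInf S) / 2 ∈ S from ⟨h2, h1⟩)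
        linarith
      · exact hB a (by push Not at h2; linarith)
    · exact h1

end concl

/-- stochastic homogenization of level-set convex Hamilton-Jacobi equations. -/
theorem statement_0
    (d : ℕ) (hd : 0 < d)
    {Ω : Type*} [MeasurableSpace Ω] (P : Measure Ω) [IsProbabilityMeasure P]
    (τ : Ed d → Ω → Ω)
    (hτmeas : ∀ y : Ed d, Measurable (τ y))
    (hτmp : ∀ y : Ed d, MeasurePreserving (τ y) P P)
    (hτgrp : ∀ x y : Ed d, τ (x + y) = τ x ∘ τ y)
    (hτzero : τ 0 = id)
    (hτerg : ∀ A : Set Ω, MeasurableSet A → (∀ z : Ed d, τ z ⁻¹' A = A) → P A = 0 ∨ P A = 1)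
    (H : Ed d → Ed d → Ω → ℝ)
    (hHmeas : Measurable fun x : Ed d × Ed d × Ω => H x.1 x.2.1 x.2.2)
    (hHstat : ∀ (p y z : Ed d) (ω : Ω), H p y (τ z ω) = H p (y + z) ω)
    (hHcont : ∀ ω : Ω, Continuous fun q : Ed d × Ed d => H q.1 q.2 ω)
    (hreg_bdd : ∀ R : ℝ, 0 < R → ∃ M : ℝ, ∀ (ω : Ω) (p y : Ed d), ‖p‖ ≤ R → |H p y ω| ≤ M)
    (hreg_uc : ∀ R : ℝ, 0 < R → ∀ ε : ℝ, 0 < ε → ∃ δ : ℝ, 0 < δ ∧ ∀ (ω : Ω) (p p' y y' : Ed d),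
      ‖p‖ ≤ R → ‖p'‖ ≤ R → ‖p - p'‖ < δ → ‖y - y'‖ < δ → |H p y ω - H p' y' ω| < ε)
    (hcoer : ∀ M : ℝ, ∃ R : ℝ, ∀ (ω : Ω) (p y : Ed d), R ≤ ‖p‖ → M ≤ H p y ω)
    (hqc : ∀ (ω : Ω) (p q y : Ed d), H ((1/2 : ℝ) • (p + q)) y ω ≤ max (H p y ω) (H q y ω))
    (Λ : ℝ → ℝ → ℝ)
    (hΛcont : Continuous fun m : ℝ × ℝ => Λ m.1 m.2)
    (hΛmono : ∀ a b a' b' : ℝ, a ≤ a' → b ≤ b' → Λ a b ≤ Λ a' b')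
    (hΛstrict : ∀ a b : ℝ, a ≠ b → Λ a b < max a b)
    (hsqc : ∀ (ω : Ω) (p q y : Ed d), H ((1/2 : ℝ) • (p + q)) y ω ≤ Λ (H p y ω) (H q y ω))
    :
    ∃ Hbar : Ed d → ℝ,
      Continuous Hbar ∧
      (∀ M : ℝ, ∃ R : ℝ, ∀ p : Ed d, R ≤ ‖p‖ → M ≤ Hbar p) ∧
      (∀ p q : Ed d, Hbar ((1/2 : ℝ) • (p + q)) ≤ max (Hbar p) (Hbar q)) ∧
      ∃ Ω₀ : Set Ω, MeasurableSet Ω₀ ∧ P Ω₀ = 1 ∧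
        ∀ ω ∈ Ω₀, ∀ u : ℝ → Ed d → ℝ,
          (∀ ε : ℝ, 0 < ε →
            (∃ M : ℝ, ∀ x : Ed d, |u ε x| ≤ M) ∧
            (∃ C : ℝ≥0, LipschitzWith C (u ε)) ∧
            Continuous (u ε) ∧
            ViscSubZero d (fun q x => H q (ε⁻¹ • x) ω) (u ε) ∧
            ViscSuperZero d (fun q x => H q (ε⁻¹ • x) ω) (u ε)) →
          TendstoLocallyUniformly (fun (ε : ℝ) (x : Ed d) => u ε x)
            (fun _ => -Hbar 0) (𝓝[>] (0:ℝ)) := by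
  obtain ⟨M0', hM0'⟩ := hreg_bdd 1 one_pos
  set M0 := |M0'| with hM0def
  have hM0 : ∀ p y ω, ‖p‖ ≤ 1 → |H p y ω| ≤ M0 := fun p y ω hp =>
    (hM0' ω p y hp).trans (le_abs_self _)
  have habs : ∀ ω ε, 0 < ε → ∀ v, VSol d (fun p y => H p y ω) ε v → ∀ x, |ε * v x| ≤ M0 := by
    intro ω ε hε v hv x
    obtain ⟨M, hM⟩ := hv.bdd
    rw [abs_le]
    exact ⟨qsuper_bound hε hv.sup hv.cont hM (fun p y => hM0 p y ω) x,
      qsub_bound hε hv.sub hv.cont hM (fun p y => hM0 p y ω) x⟩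
  have hdich : ∀ a b : ℝ, a < b → AL P H b ∨ BU P H a := by
    intro a b hab
    have hΔ : 0 < (b - a) / 2 := by linarith
    obtain ⟨pk, R, N, κ, θ, h, hp⟩ :=
      exists_params hHcont hreg_uc hcoer hqc hM0 ((a + b) / 2) hΔ
    obtain ⟨C1, D⟩ := exists_costData hp hHmeas hHstat hreg_bdd hreg_uc
    by_cases hall : ∀ e, P (Ie (bb H ((a + b) / 2) pk N κ) h (κ / 2) e) = 0
    · left
      intro K
      filter_upwards [caseA hd hp D hτmp hτgrp hτzero hHstat hall K] with ω hω
      obtain ⟨ε0, h0, h1⟩ := hω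
      exact ⟨ε0, h0, fun ε hε hε' v hv x hx => by linarith [h1 ε hε hε' v hv x hx]⟩
    · right
      push Not at hall
      obtain ⟨e, he⟩ := hall
      have he1 := (Ie_zero_one D hτgrp hτzero hτerg (κ / 2) e).resolve_left he
      intro K
      filter_upwards [caseB hp D hτmp hτgrp hτzero he1 K] with ω hω
      obtain ⟨ε0, h0, h1⟩ := hω
      exact ⟨ε0, h0, fun ε hε hε' v hv x hx => by linarith [h1 ε hε hε' v hv x hx]⟩
  have hA : AL P H M0 := fun K => Eventually.of_forall fun ω =>
    ⟨1, one_pos, fun ε hε _ v hv x _ => (abs_le.1 (habs ω ε hε v hv x)).1⟩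
  have hB : ∀ a, a ≤ -M0 → BU P H a := fun a ha K => Eventually.of_forall fun ω =>
    ⟨1, one_pos, fun ε hε _ v hv x _ => by linarith [(abs_le.1 (habs ω ε hε v hv x)).2]⟩
  obtain ⟨c, hc1, hc2⟩ := exists_level hdich hA hB (abs_nonneg _)
  refine ⟨fun p => c + ‖p‖, by fun_prop, fun M => ⟨M - c, fun p hp => by linarith⟩, ?_, ?_⟩
  · intro p q
    have h1 : ‖(1/2 : ℝ) • (p + q)‖ ≤ (‖p‖ + ‖q‖) / 2 := by
      rw [norm_smul, Real.norm_of_nonneg (by norm_num)]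
      linarith [norm_add_le p q]
    rcases le_total ‖p‖ ‖q‖ with h | h
    · exact le_max_of_le_right (by linarith)
    · exact le_max_of_le_left (by linarith)
  have hpos : ∀ n : ℕ, (0 : ℝ) < 1 / ((n : ℝ) + 1) := fun n => by positivity
  have hae : ∀ᵐ ω ∂P, ∀ n K : ℕ, ∃ ε0 : ℝ, 0 < ε0 ∧ ∀ ε : ℝ, 0 < ε → ε < ε0 → ∀ v,
      VSol d (fun p y => H p y ω) ε v → ∀ x : Ed d, ‖x‖ ≤ K / ε →
        |ε * v x + c| ≤ 1 / ((n : ℝ) + 1) := by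
    rw [ae_all_iff]
    intro n
    rw [ae_all_iff]
    intro K
    filter_upwards [hc1 (c + 1 / ((n : ℝ) + 1)) (by linarith [hpos n]) K,
      hc2 (c - 1 / ((n : ℝ) + 1)) (by linarith [hpos n]) K] with ω h1 h2
    obtain ⟨ε1, h10, h11⟩ := h1
    obtain ⟨ε2, h20, h21⟩ := h2
    refine ⟨min ε1 ε2, lt_min h10 h20, fun ε hε hε' v hv x hx => ?_⟩
    have k1 := h11 ε hε (hε'.trans_le (min_le_left _ _)) v hv x hx
    have k2 := h21 ε hε (hε'.trans_le (min_le_right _ _)) v hv x hx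
    rw [abs_le]
    constructor <;> linarith
  obtain ⟨T, hTsub, hTm, hT0⟩ := exists_measurable_superset_of_null (ae_iff.1 hae)
  refine ⟨Tᶜ, hTm.compl, (prob_compl_eq_one_iff hTm).2 hT0, ?_⟩
  intro ω hω u hu
  have hω' := not_not.1 fun hcon => hω (hTsub hcon)
  rw [Metric.tendstoLocallyUniformly_iff]
  intro η hη x0
  obtain ⟨n, hn⟩ := exists_nat_one_div_lt hη
  obtain ⟨K, hK⟩ := exists_nat_ge (‖x0‖ + 1)
  obtain ⟨ε0, h0, h1⟩ := hω' n K
  refine ⟨Metric.ball x0 1, Metric.ball_mem_nhds _ one_pos, ?_⟩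
  filter_upwards [Ioo_mem_nhdsGT h0] with ε hε x hx
  have hε0 : 0 < ε := hε.1
  obtain ⟨⟨M, hM⟩, -, hcu, hsub, hsup⟩ := hu ε hε0
  have hv : VSol d (fun p y => H p y ω) ε (fun y => ε⁻¹ * u ε (ε • y)) := by
    refine ⟨qsub_of_visc (F := fun p y => H p y ω) hε0 hsub,
      qsuper_of_visc (F := fun p y => H p y ω) hε0 hsup, by fun_prop, ε⁻¹ * M, fun y => ?_⟩
    rw [abs_mul, abs_of_pos (inv_pos.2 hε0)]
    exact mul_le_mul_of_nonneg_left (hM _) (inv_pos.2 hε0).le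
  have hxK : ‖ε⁻¹ • x‖ ≤ K / ε := by
    rw [norm_smul, Real.norm_of_nonneg (inv_pos.2 hε0).le, div_eq_inv_mul]
    apply mul_le_mul_of_nonneg_left _ (inv_pos.2 hε0).le
    rw [mem_ball_iff_norm] at hx
    have := norm_add_le (x - x0) x0
    rw [sub_add_cancel] at this
    linarith
  have h2 := h1 ε hε0 hε.2 _ hv (ε⁻¹ • x) hxK
  simp only [smul_smul, mul_inv_cancel₀ hε0.ne', one_smul, mul_inv_cancel_left₀ hε0.ne'] at h2
  rw [dist_comm, Real.dist_eq]
  simp only [norm_zero, add_zero, sub_neg_eq_add]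
  exact h2.trans_lt hn
end
end

section
/- Let U ⊆ ℝ^d be open, ν ∈ ℝ, and let v : U → ℝ be upper semicontinuous. Then v is a viscosity subsolution of H(Dv,y) ≤ ν in U if and only if v is locally Lipschitz in U and satisfies H(Dv(y), y) ≤ ν for almost every y ∈ U (the gradient Dv(y) existing almost everywhere by Rademacher's theorem). -/
open MeasureTheory Filter Topology Bornology
open scoped RealInnerProductSpace NNReal

noncomputable section

theorem aux_convex {E : Type*} [NormedAddCommGroup E] [NormedSpace ℝ E] (K : Set E)
    (hK : IsClosed K) (hmid : ∀ p ∈ K, ∀ q ∈ K, (1/2 : ℝ) • (p + q) ∈ K) : Convex ℝ K := by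
  rw [convex_iff_segment_subset]
  intro x hx y hy z hz
  rw [segment_eq_image_lineMap] at hz
  obtain ⟨t, ht, rfl⟩ := hz
  by_contra hcon
  have hcont : Continuous (fun s : ℝ => AffineMap.lineMap (k := ℝ) x y s) :=
    AffineMap.lineMap_continuous
  have hSc : IsClosed {s : ℝ | AffineMap.lineMap (k := ℝ) x y s ∈ K} := hK.preimage hcont
  obtain ⟨a, ⟨ha1, ha2⟩, ha⟩ :=
    ((isCompact_Icc (a := (0:ℝ)) (b := t)).inter_left hSc).exists_isGreatest
      ⟨0, by simpa using hx, by simpa using ht.1⟩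
  obtain ⟨b, ⟨hb1, hb2⟩, hb⟩ :=
    ((isCompact_Icc (a := t) (b := (1:ℝ))).inter_left hSc).exists_isLeast
      ⟨1, by simpa using hy, by simpa using ht.2⟩
  simp only [Set.mem_ofPred_eq] at ha1 hb1
  have hat : a < t := lt_of_le_of_ne ha2.2 (by rintro rfl; exact hcon ha1)
  have hbt : t < b := lt_of_le_of_ne hb2.1 (by rintro rfl; exact hcon hb1)
  have hm := hmid _ ha1 _ hb1
  have hmm : (1/2 : ℝ) • (AffineMap.lineMap (k := ℝ) x y a + AffineMap.lineMap (k := ℝ) x y b)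
      = AffineMap.lineMap (k := ℝ) x y ((a+b)/2) := by
    simp only [AffineMap.lineMap_apply_module]
    module
  rw [hmm] at hm
  rcases le_total ((a+b)/2) t with h | h
  · have := ha ⟨hm, ⟨by linarith [ha2.1], h⟩⟩
    linarith
  · have := hb ⟨hm, ⟨h, by linarith [hb2.2]⟩⟩
    linarith

theorem aux_line {d : ℕ} (v : Ed d → ℝ) (x₀ e : Ed d) (r c : ℝ) (C : ℝ≥0)
    (hLip : LipschitzOnWith C v (Metric.ball x₀ r))
    (hae : ∀ᵐ y ∂(volume : Measure (Ed d)), y ∈ Metric.ball x₀ r →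
      DifferentiableAt ℝ v y ∧ fderiv ℝ v y e ≤ c)
    (t : ℝ) (ht : 0 ≤ t) (htr : t * ‖e‖ < r) : v x₀ - v (x₀ - t • e) ≤ c * t := by
  obtain ⟨N, hsub, hmeas, hnull⟩ := exists_measurable_superset_of_null (ae_iff.1 hae)
  have hfub : ∀ᵐ x ∂(volume : Measure (Ed d)), ∀ᵐ s ∂(volume : Measure ℝ), x + s • e ∉ N := by
    rw [Measure.ae_ae_comm]
    · refine Eventually.of_forall fun s => ?_
      rw [ae_iff]
      have : {a : Ed d | ¬ (a + s • e ∉ N)} = (fun a => a + s • e) ⁻¹' N := by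
        ext a; simp
      rw [this, measure_preimage_add_right]
      exact hnull
    · have : Measurable (fun x : Ed d × ℝ => x.1 + x.2 • e) := by fun_prop
      exact (this hmeas).compl
  have hdense := Measure.dense_of_ae hfub
  by_contra! hcon
  have hr : 0 < r := lt_of_le_of_lt (by positivity) htr
  have hn1 : Metric.ball x₀ r ∈ 𝓝 x₀ := Metric.ball_mem_nhds _ hr
  have hmem2 : x₀ - t • e ∈ Metric.ball x₀ r := by
    simp [Metric.mem_ball, dist_eq_norm, norm_smul, abs_of_nonneg ht, htr]
  have hc1 : ContinuousAt v x₀ := hLip.continuousOn.continuousAt hn1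
  have hc2 : ContinuousAt v (x₀ - t • e) :=
    hLip.continuousOn.continuousAt (Metric.isOpen_ball.mem_nhds hmem2)
  have hc3 : ContinuousAt (fun x => v x - v (x - t • e)) x₀ :=
    hc1.sub (ContinuousAt.comp (f := fun x => x - t • e) hc2 (by fun_prop))
  have hev := hc3.eventually (lt_mem_nhds hcon)
  have hball : ∀ᶠ x in 𝓝 x₀, x ∈ Metric.ball x₀ (r - t * ‖e‖) :=
    Metric.ball_mem_nhds _ (by linarith)
  obtain ⟨x, hx, hgood⟩ := (mem_closure_iff_frequently.1 (hdense x₀)).and_eventually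
    (hev.and hball) |>.exists
  obtain ⟨hx1, hx2⟩ := hgood
  simp only [Set.mem_ofPred_eq] at hx
  have hin : ∀ s ∈ Set.Icc (-t) 0, x + s • e ∈ Metric.ball x₀ r := by
    intro s hs
    rw [Metric.mem_ball, dist_eq_norm] at *
    have h1 : ‖s • e‖ ≤ t * ‖e‖ := by
      rw [norm_smul, Real.norm_eq_abs]
      gcongr
      rw [abs_le]; exact ⟨hs.1, by linarith [hs.2]⟩
    calc ‖x + s • e - x₀‖ = ‖(x - x₀) + s • e‖ := by congr 1; abel
      _ ≤ ‖x - x₀‖ + ‖s • e‖ := norm_add_le _ _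
      _ < r := by linarith
  have hLg : LipschitzOnWith (C * ‖e‖₊) (fun s : ℝ => v (x + s • e)) (Set.uIcc (-t) 0) := by
    rw [Set.uIcc_of_le (by linarith)]
    refine LipschitzOnWith.of_dist_le_mul fun a ha b hb => ?_
    refine (hLip.dist_le_mul _ (hin a ha) _ (hin b hb)).trans (le_of_eq ?_)
    rw [dist_add_left, dist_eq_norm, ← sub_smul, norm_smul, dist_eq_norm]
    push_cast; ring
  have hAC := hLg.absolutelyContinuousOnInterval
  have hint := hAC.integral_deriv_eq_sub
  have hmono : ∫ s in (-t)..0, deriv (fun s : ℝ => v (x + s • e)) s ≤ ∫ s in (-t)..0, c := by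
    refine intervalIntegral.integral_mono_ae_restrict (by linarith) hAC.intervalIntegrable_deriv
      (by simp) ?_
    rw [Filter.EventuallyLE, ae_restrict_iff' measurableSet_Icc]
    filter_upwards [hx] with s hs hsI
    have hg : x + s • e ∈ Metric.ball x₀ r →
      DifferentiableAt ℝ v (x + s • e) ∧ fderiv ℝ v (x + s • e) e ≤ c := by
      by_contra h; exact hs (hsub h)
    obtain ⟨hd, hle⟩ := hg (hin s hsI)
    have hl : HasDerivAt (fun s : ℝ => x + s • e) e s := by
      simpa using ((hasDerivAt_id s).smul_const e).const_add x
    have := hd.hasFDerivAt.comp_hasDerivAt s hl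
    have h3 : deriv (fun s : ℝ => v (x + s • e)) s = fderiv ℝ v (x + s • e) e := this.deriv
    rw [h3]; exact hle
  rw [hint] at hmono
  simp at hmono
  have : x + -(t • e) = x - t • e := by abel
  rw [this] at hmono
  nlinarith

theorem aux_back {d : ℕ} (H : Ed d → Ed d → ℝ)
    (hHcont : Continuous fun q : Ed d × Ed d => H q.1 q.2)
    (hreg_uc : ∀ R : ℝ, 0 < R → ∀ ε : ℝ, 0 < ε → ∃ δ : ℝ, 0 < δ ∧ ∀ p p' y y' : Ed d,
      ‖p‖ ≤ R → ‖p'‖ ≤ R → ‖p - p'‖ < δ → ‖y - y'‖ < δ → |H p y - H p' y'| < ε)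
    (hqc : ∀ p q y : Ed d, H ((1/2 : ℝ) • (p + q)) y ≤ max (H p y) (H q y))
    (U : Set (Ed d)) (hU : IsOpen U) (ν : ℝ) (v : Ed d → ℝ)
    (hL : ∀ x ∈ U, ∃ (C : ℝ≥0) (t : Set (Ed d)), t ∈ 𝓝 x ∧ t ⊆ U ∧ LipschitzOnWith C v t)
    (hae : ∀ᵐ y ∂volume, y ∈ U → DifferentiableAt ℝ v y ∧ H (gradient v y) y ≤ ν) :
    ViscSub d H ν U v := by
  intro φ x₀ hx₀ hφ hmax
  by_contra! hcon
  obtain ⟨C, T, hT, hTU, hLip⟩ := hL x₀ hx₀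
  set p := gradient φ x₀ with hp
  set δ := (H p x₀ - ν) / 2 with hδ
  have hδ0 : 0 < δ := by rw [hδ]; linarith
  set K : Set (Ed d) := {q | H q x₀ ≤ ν + δ} with hK
  have hKc : IsClosed K := by
    have : Continuous fun q : Ed d => H q x₀ := hHcont.comp (by fun_prop : Continuous fun q : Ed d => (q, x₀))
    exact isClosed_le this continuous_const
  have hKconv : Convex ℝ K := aux_convex K hKc fun p hp q hq =>
    (hqc p q x₀).trans (max_le hp hq)
  have hpK : p ∉ K := by
    simp only [hK, Set.mem_ofPred_eq, not_le]; linarith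
  obtain ⟨f, c, hf1, hf2⟩ := geometric_hahn_banach_closed_point hKconv hKc hpK
  set e : Ed d := (InnerProductSpace.toDual ℝ (Ed d)).symm f with he
  have hfe : ∀ q : Ed d, f q = ⟪e, q⟫ := fun q => by
    rw [he, InnerProductSpace.toDual_symm_apply]
  have hgr : ∀ (w : Ed d → ℝ) (y : Ed d), fderiv ℝ w y e = f (gradient w y) := by
    intro w y
    rw [hfe, real_inner_comm, gradient, InnerProductSpace.toDual_symm_apply]
  obtain ⟨η, hη, huc⟩ := hreg_uc (C + 1) (by positivity) δ hδ0
  obtain ⟨r₁, hr₁, hball⟩ := Metric.mem_nhds_iff.1 hT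
  set r := min r₁ η with hr
  have hr0 : 0 < r := lt_min hr₁ hη
  have hsub : Metric.ball x₀ r ⊆ T := (Metric.ball_subset_ball (min_le_left _ _)).trans hball
  have hae' : ∀ᵐ y ∂(volume : Measure (Ed d)), y ∈ Metric.ball x₀ r →
      DifferentiableAt ℝ v y ∧ fderiv ℝ v y e ≤ c := by
    filter_upwards [hae] with y hy hyb
    obtain ⟨h1, h2⟩ := hy (hTU (hsub hyb))
    refine ⟨h1, ?_⟩
    rw [hgr]
    refine (hf1 _ ?_).le
    have hn : ‖gradient v y‖ ≤ C + 1 := by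
      rw [gradient, LinearIsometryEquiv.norm_map]
      have := norm_fderiv_le_of_lipschitzOn ℝ
        (mem_of_superset (Metric.isOpen_ball.mem_nhds hyb) hsub) hLip
      linarith
    have := huc (gradient v y) (gradient v y) x₀ y hn hn (by simpa using hη) (by
      rw [Metric.mem_ball, dist_comm, dist_eq_norm] at hyb
      exact lt_of_lt_of_le hyb (min_le_right _ _))
    have := (abs_lt.1 this).2
    simp only [hK, Set.mem_ofPred_eq]; linarith
  have hline := aux_line v x₀ e r c C (hLip.mono hsub) hae'
  -- derivative of φ along -e
  have hφd : HasFDerivAt φ (fderiv ℝ φ x₀) x₀ :=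
    (hφ.differentiableAt (by norm_num)).hasFDerivAt
  have hder : HasDerivAt (fun t : ℝ => φ (x₀ - t • e)) (-(f p)) 0 := by
    have hl : HasDerivAt (fun s : ℝ => x₀ - s • e) (-e) 0 := by
      simpa using ((hasDerivAt_id (0:ℝ)).smul_const e).const_sub x₀
    have h0 : HasFDerivAt φ (fderiv ℝ φ x₀) (x₀ - (0:ℝ) • e) := by simpa using hφd
    have := h0.comp_hasDerivAt (0:ℝ) hl
    rw [map_neg, hgr] at this
    exact this
  have hslope := hder.tendsto_slope_zero_right
  have hev1 := hslope.eventually (gt_mem_nhds (show -(f p) < -c by linarith))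
  have hmax' : ∀ᶠ y in 𝓝 x₀, v y - φ y ≤ v x₀ - φ x₀ := by
    have := hmax
    rw [IsLocalMaxOn, hU.nhdsWithin_eq hx₀] at this
    exact this
  have htend : Tendsto (fun t : ℝ => x₀ - t • e) (𝓝[>] 0) (𝓝 x₀) := by
    have : Continuous (fun t : ℝ => x₀ - t • e) := by fun_prop
    have h := this.tendsto 0
    simp only [zero_smul, sub_zero] at h
    exact h.mono_left nhdsWithin_le_nhds
  have hev2 := htend.eventually hmax'
  have hev3 : ∀ᶠ t : ℝ in 𝓝[>] 0, t * ‖e‖ < r := by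
    have : Continuous (fun t : ℝ => t * ‖e‖) := by fun_prop
    have h := this.tendsto 0
    simp only [zero_mul] at h
    exact (h.mono_left nhdsWithin_le_nhds).eventually (gt_mem_nhds hr0)
  obtain ⟨t, ⟨⟨h1, h2⟩, h3⟩, h4⟩ :=
    (((hev1.and hev2).and hev3).and self_mem_nhdsWithin).exists
  have h4 : 0 < t := h4
  have h5 := hline t h4.le h3
  simp only [zero_add, zero_smul, sub_zero, smul_eq_mul] at h1
  rw [inv_mul_lt_iff₀ h4] at h1
  nlinarith

theorem aux_lip {d : ℕ} (H : Ed d → Ed d → ℝ)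
    (hcoer : ∀ M : ℝ, ∃ R : ℝ, ∀ p y : Ed d, R ≤ ‖p‖ → M ≤ H p y)
    (U : Set (Ed d)) (hU : IsOpen U) (ν : ℝ)
    (v : Ed d → ℝ) (hv : UpperSemicontinuousOn v U) (hsub : ViscSub d H ν U v) :
    ∀ x ∈ U, ∃ (C : ℝ≥0) (t : Set (Ed d)), t ∈ 𝓝 x ∧ t ⊆ U ∧ LipschitzOnWith C v t := by
  intro x₀ hx₀
  obtain ⟨R₀, hR₀⟩ := hcoer (ν + 1)
  set R : ℝ := max R₀ 1 with hRdef
  have hR1 : 1 ≤ R := le_max_right _ _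
  have hR : ∀ p y : Ed d, H p y ≤ ν → ‖p‖ < R := by
    intro p y h
    by_contra! hc
    have := hR₀ p y ((le_max_left _ _).trans hc)
    linarith
  obtain ⟨ρ, hρ, hball⟩ := Metric.isOpen_iff.1 hU x₀ hx₀
  set r : ℝ := ρ / 6 with hr
  have hr0 : 0 < r := by positivity
  have hcb : Metric.closedBall x₀ (5 * r) ⊆ U :=
    (Metric.closedBall_subset_ball (by rw [hr]; linarith)).trans hball
  -- upper bound
  obtain ⟨z, hz, hzmax⟩ := (hv.mono hcb).exists_isMaxOn (⟨x₀, by simp; positivity⟩)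
    (isCompact_closedBall x₀ (5 * r))
  have key : ∀ x ∈ Metric.ball x₀ (r/2), ∀ y ∈ Metric.ball x₀ (r/2),
      v y - v x ≤ 2 * R * dist y x := by
    intro x hx y hy
    rw [Metric.mem_ball] at hx hy
    have hxU : Metric.closedBall x (2 * r) ⊆ Metric.closedBall x₀ (5 * r) :=
      Metric.closedBall_subset_closedBall' (by linarith)
    set g : ℝ → ℝ := fun s => R * (2 * r) * s / (2 * r - s) with hg
    set M : ℝ := |v z - v x| + 1 with hM
    have hM0 : 0 < M := by positivity
    -- s₁ with g s₁ > M, and s₁ ≥ r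
    obtain ⟨s₁, hs1, hs2, hs3⟩ : ∃ s₁, r ≤ s₁ ∧ s₁ < 2 * r ∧ M < g s₁ := by
      have hrR : 0 < R * r := by positivity
      refine ⟨2 * r - r * (R * r) / (R * r + M), ?_, ?_, ?_⟩
      · have : r * (R * r) / (R * r + M) ≤ r := by
          rw [div_le_iff₀ (by positivity)]; nlinarith
        linarith
      · have : 0 < r * (R * r) / (R * r + M) := by positivity
        linarith
      · have h1 : r * (R * r) / (R * r + M) ≤ r := by
          rw [div_le_iff₀ (by positivity)]; nlinarith
        have h0 : 0 < r * (R * r) / (R * r + M) := by positivity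
        simp only [hg]
        rw [lt_div_iff₀ (by linarith)]
        have h2 : M * (r * (R * r) / (R * r + M)) < r * (R * r) := by
          rw [← mul_div_assoc, div_lt_iff₀ (by positivity)]
          have : 0 < r * (R * r) * (R * r) := by positivity
          nlinarith
        have h3 : r * (R * r) ≤ R * (2 * r) * (2 * r - r * (R * r) / (R * r + M)) := by
          have : r ≤ 2 * r - r * (R * r) / (R * r + M) := by linarith
          have h5 : R * (2 * r) * r ≤ R * (2 * r) * (2 * r - r * (R * r) / (R * r + M)) := by
            gcongr
          nlinarith
        have : 2 * r - (2 * r - r * (R * r) / (R * r + M)) = r * (R * r) / (R * r + M) := by ring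
        rw [this]; linarith
    have hs1U : Metric.closedBall x s₁ ⊆ Metric.closedBall x₀ (5 * r) :=
      (Metric.closedBall_subset_closedBall hs2.le).trans hxU
    set ψ : Ed d → ℝ := fun w => g ‖w - x‖ with hψ
    have hψc : ContinuousOn ψ (Metric.closedBall x s₁) := by
      refine ContinuousOn.div (by fun_prop) (by fun_prop) ?_
      intro w hw
      rw [Metric.mem_closedBall, dist_eq_norm] at hw
      have : 0 < 2 * r - ‖w - x‖ := by linarith
      exact this.ne'
    have hus : UpperSemicontinuousOn (fun w => v w + (- ψ w)) (Metric.closedBall x s₁) :=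
      (hv.mono (hs1U.trans hcb)).add hψc.neg.upperSemicontinuousOn
    obtain ⟨w, hw, hwmax⟩ := hus.exists_isMaxOn (⟨x, by simp; linarith⟩)
      (isCompact_closedBall x s₁)
    have hψx : ψ x = 0 := by simp [hψ, hg]
    have hwx := hwmax (show x ∈ Metric.closedBall x s₁ by simp; linarith)
    simp only [Set.mem_ofPred_eq, hψx] at hwx
    have hwlt : ‖w - x‖ < s₁ := by
      rw [Metric.mem_closedBall, dist_eq_norm] at hw
      refine lt_of_le_of_ne hw ?_
      intro heq
      have h1 : ψ w = g s₁ := by simp [hψ, heq]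
      have h2 : v w ≤ v z := hzmax (hs1U (by rw [Metric.mem_closedBall, dist_eq_norm, heq]))
      have := le_abs_self (v z - v x)
      linarith
    have hweq : w = x := by
      by_contra hne
      have hnn : w - x ≠ 0 := sub_ne_zero.2 hne
      have hnpos : 0 < ‖w - x‖ := norm_pos_iff.2 hnn
      have hden : 2 * r - ‖w - x‖ ≠ 0 := by
        have : 0 < 2 * r - ‖w - x‖ := by linarith
        exact this.ne'
      have hcd : ContDiffAt ℝ 1 ψ w := by
        have hnorm : ContDiffAt ℝ 1 (fun w : Ed d => ‖w - x‖) w :=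
          (contDiffAt_id.sub contDiffAt_const).norm ℝ hnn
        exact (contDiffAt_const.mul hnorm).div (contDiffAt_const.sub hnorm) hden
      have hloc : IsLocalMaxOn (fun y => v y - ψ y) U w := by
        refine IsLocalMax.on ?_ U
        have : Metric.closedBall x s₁ ∈ 𝓝 w :=
          mem_of_superset (Metric.isOpen_ball.mem_nhds (by
            rw [Metric.mem_ball, dist_eq_norm]; exact hwlt)) Metric.ball_subset_closedBall
        filter_upwards [this] with a ha
        have := hwmax ha
        simp only [Set.mem_ofPred_eq] at this
        linarith
      have hH := hsub ψ w (hcb (hs1U hw)) hcd hloc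
      have hlt := hR _ _ hH
      rw [gradient, LinearIsometryEquiv.norm_map] at hlt
      -- directional derivative
      set n := ‖w - x‖ with hn
      have hl : HasDerivAt (fun s : ℝ => x + s • (w - x)) (w - x) 1 := by
        simpa using ((hasDerivAt_id (1:ℝ)).smul_const (w - x)).const_add x
      have h0 : HasFDerivAt ψ (fderiv ℝ ψ w) (x + (1:ℝ) • (w - x)) := by
        have := (hcd.differentiableAt (by norm_num)).hasFDerivAt
        simpa using this
      have hd1 := h0.comp_hasDerivAt (1:ℝ) hl
      have hd2 : HasDerivAt (fun s : ℝ => R * (2 * r) * (s * n) / (2 * r - s * n))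
          ((R * (2 * r) * n * (2 * r - 1 * n) - R * (2 * r) * (1 * n) * (- n)) / (2 * r - 1 * n)^2) 1 := by
        have hi : HasDerivAt (fun s : ℝ => s * n) n 1 := by
          simpa using (hasDerivAt_id (1:ℝ)).mul_const n
        exact (hi.const_mul _).div (hi.const_sub _) (by simpa using hden)
      have heq : (ψ ∘ fun s : ℝ => x + s • (w - x)) =ᶠ[𝓝 1]
          (fun s : ℝ => R * (2 * r) * (s * n) / (2 * r - s * n)) := by
        filter_upwards [lt_mem_nhds (show (0:ℝ) < 1 by norm_num)] with s hs
        simp [hψ, hg, norm_smul, abs_of_pos hs, hn]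
      have hval := (hd2.congr_of_eventuallyEq heq).unique hd1
      have hle : fderiv ℝ ψ w (w - x) ≤ ‖fderiv ℝ ψ w‖ * n :=
        (le_abs_self _).trans ((fderiv ℝ ψ w).le_opNorm _)
      rw [← hval] at hle
      have hpos : 0 < 2 * r - 1 * n := by linarith
      have : R * n ≤ (R * (2 * r) * n * (2 * r - 1 * n) - R * (2 * r) * (1 * n) * (- n)) / (2 * r - 1 * n)^2 := by
        rw [le_div_iff₀ (by positivity)]
        have h1 : (2 * r - 1 * n)^2 ≤ (2*r)^2 := by
          apply pow_le_pow_left₀ hpos.le; linarith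
        have h2 : R * n * (2 * r - 1 * n)^2 ≤ R * n * (2*r)^2 := by gcongr
        linarith
      nlinarith
    subst hweq
    have hyd : dist y w ≤ r := by
      have := dist_triangle_right y w x₀
      linarith
    have hym := hwmax (show y ∈ Metric.closedBall w s₁ by
      rw [Metric.mem_closedBall]; linarith)
    simp only [Set.mem_ofPred_eq, hψx] at hym
    have hgy : ψ y ≤ 2 * R * dist y w := by
      simp only [hψ, hg]
      rw [← dist_eq_norm, div_le_iff₀ (by linarith)]
      have : 0 ≤ R * dist y w := by positivity
      nlinarith
    linarith
  refine ⟨Real.toNNReal (2 * R), Metric.ball x₀ (r/2), Metric.ball_mem_nhds _ (by positivity),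
    (Metric.ball_subset_closedBall.trans (Metric.closedBall_subset_closedBall (by linarith))).trans hcb, ?_⟩
  refine LipschitzOnWith.of_dist_le_mul fun a ha b hb => ?_
  rw [Real.dist_eq, abs_le]
  have h1 := key a ha b hb
  have h2 := key b hb a ha
  rw [dist_comm b a] at h1
  rw [Real.coe_toNNReal _ (by positivity)]
  constructor <;> linarith

theorem aux_point {d : ℕ} (H : Ed d → Ed d → ℝ)
    (hHcont : Continuous fun q : Ed d × Ed d => H q.1 q.2)
    (U : Set (Ed d)) (hU : IsOpen U) (ν : ℝ)
    (v : Ed d → ℝ) (hv : UpperSemicontinuousOn v U) (hsub : ViscSub d H ν U v)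
    (y : Ed d) (hy : y ∈ U) (hd : DifferentiableAt ℝ v y) : H (gradient v y) y ≤ ν := by
  by_contra! hcon
  set p := gradient v y with hp
  have hev : ∀ᶠ q : Ed d × Ed d in 𝓝 (p, y), ν < H q.1 q.2 :=
    hHcont.continuousAt.eventually (lt_mem_nhds hcon)
  obtain ⟨η, hη, hηb⟩ := Metric.eventually_nhds_iff.1 hev
  set ε := η / 8 with hε
  have hε0 : 0 < ε := by positivity
  have hgr : ∀ z, fderiv ℝ v y z = ⟪p, z⟫ := fun z => by
    rw [hp, gradient, InnerProductSpace.toDual_symm_apply]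
  have hlo := hd.hasFDerivAt.isLittleO.bound hε0
  obtain ⟨ρ₁, hρ₁, hb1⟩ := Metric.eventually_nhds_iff.1 hlo
  obtain ⟨ρ₂, hρ₂, hb2⟩ := Metric.isOpen_iff.1 hU y hy
  set ρ := min (min ρ₁ ρ₂) η / 2 with hρ
  have hm0 : 0 < min (min ρ₁ ρ₂) η := lt_min (lt_min hρ₁ hρ₂) hη
  have hρ0 : 0 < ρ := by positivity
  have hρ1 : ρ < ρ₁ := by
    have : min (min ρ₁ ρ₂) η ≤ ρ₁ := (min_le_left _ _).trans (min_le_left _ _)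
    rw [hρ]; linarith
  have hρ2 : ρ < ρ₂ := by
    have : min (min ρ₁ ρ₂) η ≤ ρ₂ := (min_le_left _ _).trans (min_le_right _ _)
    rw [hρ]; linarith
  have hρ3 : ρ < η := by
    have : min (min ρ₁ ρ₂) η ≤ η := (min_le_right _ _)
    rw [hρ]; linarith
  have hcb : Metric.closedBall y ρ ⊆ U := (Metric.closedBall_subset_ball hρ2).trans hb2
  set φ : Ed d → ℝ := fun z => ⟪p, z⟫ + (2 * ε / ρ) * ‖z - y‖ ^ 2 with hφ
  have hcd : ContDiff ℝ 1 φ := by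
    have : ContDiff ℝ 1 (fun z : Ed d => ‖z - y‖ ^ 2) := (contDiff_id.sub contDiff_const).norm_sq ℝ
    exact (contDiff_const.inner ℝ contDiff_id).add (contDiff_const.mul this)
  have hus : UpperSemicontinuousOn (fun w => v w + (- φ w)) (Metric.closedBall y ρ) :=
      (hv.mono hcb).add hcd.continuous.continuousOn.neg.upperSemicontinuousOn
  obtain ⟨w, hw, hwmax⟩ := hus.exists_isMaxOn (⟨y, by simp; linarith⟩)
      (isCompact_closedBall y ρ)
  have hwy := hwmax (show y ∈ Metric.closedBall y ρ by simp; linarith)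
  simp only [Set.mem_ofPred_eq] at hwy
  have hφy : φ y = ⟪p, y⟫ := by simp [hφ]
  rw [Metric.mem_closedBall, dist_eq_norm] at hw
  have hwlt : ‖w - y‖ < ρ := by
    refine lt_of_le_of_ne hw ?_
    intro heq
    have h1 := hb1 (show dist w y < ρ₁ by rw [dist_eq_norm]; linarith)
    rw [hgr, heq, inner_sub_right] at h1
    have h2 := (le_abs_self _).trans h1
    have h3 : φ w = ⟪p, w⟫ + 2 * ε * ρ := by
      simp only [hφ, heq]; field_simp
    rw [hφy, h3] at hwy
    have : 0 < ε * ρ := by positivity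
    linarith
  have hloc : IsLocalMaxOn (fun y => v y - φ y) U w := by
    refine IsLocalMax.on ?_ U
    have : Metric.closedBall y ρ ∈ 𝓝 w :=
      mem_of_superset (Metric.isOpen_ball.mem_nhds (by
        rw [Metric.mem_ball, dist_eq_norm]; exact hwlt)) Metric.ball_subset_closedBall
    filter_upwards [this] with a ha
    have := hwmax ha
    simp only [Set.mem_ofPred_eq] at this
    linarith
  have hH := hsub φ w (hcb (by rw [Metric.mem_closedBall, dist_eq_norm]; exact hw))
    hcd.contDiffAt hloc
  have hgrad : HasGradientAt φ (p + (4 * ε / ρ) • (w - y)) w := by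
    rw [hasGradientAt_iff_hasFDerivAt]
    have h1 : HasFDerivAt (fun z : Ed d => ⟪p, z⟫) (innerSL ℝ p) w := (innerSL ℝ p).hasFDerivAt
    have h2 : HasFDerivAt (fun z : Ed d => ‖z - y‖ ^ 2) (2 • (innerSL ℝ (w - y))) w := by
      have := ((hasFDerivAt_id w).sub_const y).norm_sq
      simpa using this
    have h3 := h1.add (h2.const_mul (2 * ε / ρ))
    refine HasFDerivAt.congr_fderiv h3 ?_
    symm
    refine ContinuousLinearMap.ext fun z => ?_
    rw [InnerProductSpace.toDual_apply_apply, inner_add_left, real_inner_smul_left]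
    change _ = ⟪p, z⟫ + (2 * ε / ρ) * (2 • ⟪w - y, z⟫)
    rw [nsmul_eq_mul]
    push_cast
    ring
  rw [hgrad.gradient] at hH
  have hfin : ν < H (p + (4 * ε / ρ) • (w - y)) w := by
    refine hηb (y := (p + (4 * ε / ρ) • (w - y), w)) ?_
    rw [Prod.dist_eq]
    refine max_lt ?_ ?_
    · simp only [dist_self_add_left, norm_smul, Real.norm_eq_abs]
      rw [abs_of_pos (by positivity)]
      calc 4 * ε / ρ * ‖w - y‖ ≤ 4 * ε / ρ * ρ := by gcongr
        _ = 4 * ε := by field_simp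
        _ < η := by rw [hε]; linarith
    · simp only [dist_eq_norm]; linarith
  linarith

theorem aux_ae {d : ℕ} (U : Set (Ed d)) (v : Ed d → ℝ)
    (hL : ∀ x ∈ U, ∃ (C : ℝ≥0) (t : Set (Ed d)), t ∈ 𝓝 x ∧ t ⊆ U ∧ LipschitzOnWith C v t) :
    ∀ᵐ y ∂(volume : Measure (Ed d)), y ∈ U → DifferentiableAt ℝ v y := by
  rw [ae_iff]
  refine measure_null_of_locally_null _ fun x hx => ?_
  have hxU : x ∈ U := by
    by_contra h; exact hx fun h' => absurd h' h
  obtain ⟨C, t, ht, htU, hLip⟩ := hL x hxU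
  obtain ⟨r, hr, hb⟩ := Metric.mem_nhds_iff.1 ht
  refine ⟨_, inter_mem_nhdsWithin _ (Metric.ball_mem_nhds x hr), ?_⟩
  have h := (hLip.mono hb).ae_differentiableWithinAt_of_mem (μ := volume)
  rw [ae_iff] at h
  refine measure_mono_null ?_ h
  rintro y ⟨hy1, hy2⟩ hy3
  exact hy1 fun _ => (hy3 hy2).differentiableAt (Metric.isOpen_ball.mem_nhds hy2)

/-- a USC function is a viscosity subsolution of `H(Dv,y) ≤ ν` in an open
set `U` iff it is locally Lipschitz in `U` and satisfies the inequality a.e. in `U`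
(the gradient existing a.e. by Rademacher's theorem). -/
theorem statement_1
    (d : ℕ) (hd : 0 < d)
    (H : Ed d → Ed d → ℝ)
    (hHcont : Continuous fun q : Ed d × Ed d => H q.1 q.2)
    (hreg_bdd : ∀ R : ℝ, 0 < R → ∃ M : ℝ, ∀ p y : Ed d, ‖p‖ ≤ R → |H p y| ≤ M)
    (hreg_uc : ∀ R : ℝ, 0 < R → ∀ ε : ℝ, 0 < ε → ∃ δ : ℝ, 0 < δ ∧ ∀ p p' y y' : Ed d,
      ‖p‖ ≤ R → ‖p'‖ ≤ R → ‖p - p'‖ < δ → ‖y - y'‖ < δ → |H p y - H p' y'| < ε)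
    (hcoer : ∀ M : ℝ, ∃ R : ℝ, ∀ p y : Ed d, R ≤ ‖p‖ → M ≤ H p y)
    (hqc : ∀ p q y : Ed d, H ((1/2 : ℝ) • (p + q)) y ≤ max (H p y) (H q y))
    (U : Set (Ed d)) (hU : IsOpen U) (ν : ℝ)
    (v : Ed d → ℝ) (hv : UpperSemicontinuousOn v U) :
    ViscSub d H ν U v ↔
      ((∀ x ∈ U, ∃ (C : ℝ≥0) (t : Set (Ed d)), t ∈ 𝓝 x ∧ t ⊆ U ∧ LipschitzOnWith C v t) ∧
        ∀ᵐ y ∂volume, y ∈ U → DifferentiableAt ℝ v y ∧ H (gradient v y) y ≤ ν) := by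
  constructor
  · intro h
    have hL := aux_lip H hcoer U hU ν v hv h
    refine ⟨hL, ?_⟩
    filter_upwards [aux_ae U v hL] with y hy hyU
    exact ⟨hy hyU, aux_point H hHcont U hU ν v hv h y hyU (hy hyU)⟩
  · rintro ⟨hL, hae⟩
    exact aux_back H hHcont hreg_uc hqc U hU ν v hL hae
end
end
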